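/- arXiv:2010.01756 — 5 statements merged into one kernel-verified Lean document; each statement's English description precedes it below -/
import Mathlib

section
/- Let (σ_t) be the cyclic dynamics with parameter p ∈ (0,1) on Σ_n, let d^{(n)}(t) = max over initial configurations σ_0 ∈ Σ_n of the total variation distance between the law of σ_t started from σ_0 and the uniform distribution μ_n on Σ_n, and set t(n) = (1/(3p)) n log n. Then the cyclic dynamics exhibit cutoff at t(n) with window of size O(n): lim_{α→−∞} liminf_{n→∞} d^{(n)}(⌊t(n)+αn⌋) = 1 and lim_{α→∞} limsup_{n→∞} d^{(n)}(⌊t(n)+αn⌋) = 0. -/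
open Finset Filter

/-- Configuration space `Σ_n = {1,2,3}^{V_n}`, colors encoded as `Fin 3`. -/
abbrev Config (n : ℕ) := Fin n → Fin 3

/-- Transition matrix of the cyclic dynamics with parameter `p` on `Σ_n`:
a vertex `v` is chosen uniformly; its color is kept with probability `1-p`
and advanced cyclically by one with probability `p`. -/
noncomputable def cyclicP (n : ℕ) (p : ℝ) : Matrix (Config n) (Config n) ℝ :=
  Matrix.of fun σ τ => (1 / (n : ℝ)) * ∑ v : Fin n,
    ((1 - p) * (if τ = σ then (1 : ℝ) else 0)
      + p * (if τ = Function.update σ v (σ v + 1) then (1 : ℝ) else 0))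

/-- Law of the chain at time `t` started from `σ0`. -/
noncomputable def lawAt (n : ℕ) (p : ℝ) (σ0 : Config n) (t : ℕ) : Config n → ℝ :=
  fun τ => ((cyclicP n p) ^ t) σ0 τ

/-- Total variation distance `max_{A ⊆ X} |μ(A) - ν(A)|` on a finite space. -/
noncomputable def tvDist {X : Type*} [Fintype X] (μ ν : X → ℝ) : ℝ :=
  ⨆ A : Finset X, |∑ x ∈ A, μ x - ∑ x ∈ A, ν x|

/-- Uniform measure `μ_n` on `Σ_n`. -/
noncomputable def unif (n : ℕ) : Config n → ℝ := fun _ => 1 / 3 ^ n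

/-- Maximal distance `d^{(n)}(t)` to stationarity. -/
noncomputable def dmax (n : ℕ) (p : ℝ) (t : ℕ) : ℝ :=
  ⨆ σ0 : Config n, tvDist (lawAt n p σ0 t) (unif n)

namespace CyclicDynamics

/-- The primitive cube root of unity `exp(2πi/3)`. -/
noncomputable def cubeRoot : ℂ := ⟨-1 / 2, √3 / 2⟩

lemma sqrt_three_mul_self : √3 * √3 = (3 : ℝ) := Real.mul_self_sqrt (by norm_num)

lemma cubeRoot_sq : cubeRoot ^ 2 = ⟨-1 / 2, -(√3 / 2)⟩ := by
  rw [pow_two]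
  apply Complex.ext
  · simp [cubeRoot]; nlinarith [sqrt_three_mul_self]
  · simp [cubeRoot]; ring

lemma cubeRoot_sq_eq : cubeRoot ^ 2 = -1 - cubeRoot := by
  rw [cubeRoot_sq]
  apply Complex.ext <;> simp [cubeRoot]
  norm_num

lemma conj_cubeRoot : (starRingEnd ℂ) cubeRoot = -1 - cubeRoot := by
  rw [← cubeRoot_sq_eq, cubeRoot_sq]
  apply Complex.ext <;> simp [cubeRoot]

/-- The characters of the cyclic group of order three. -/
noncomputable def chi (a b : Fin 3) : ℂ := cubeRoot ^ (a.val * b.val)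

lemma chi_comm (a b : Fin 3) : chi a b = chi b a := by
  simp [chi, mul_comm]

lemma chi_add_one (a b : Fin 3) : chi a (b + 1) = cubeRoot ^ a.val * chi a b := by
  have h := cubeRoot_sq_eq
  fin_cases a <;> fin_cases b <;> simp [chi] <;> grind

lemma chi_zero_left (b : Fin 3) : chi 0 b = 1 := by simp [chi]

lemma chi_mul_conj (a b : Fin 3) : chi a b * (starRingEnd ℂ) (chi a b) = 1 := by
  have h := cubeRoot_sq_eq
  fin_cases a <;> fin_cases b <;> simp [chi, conj_cubeRoot] <;> grind

lemma sum_chi_mul_conj (b c : Fin 3) :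
    ∑ a, chi a b * (starRingEnd ℂ) (chi a c) = if b = c then 3 else 0 := by
  have h := cubeRoot_sq_eq
  fin_cases b <;> fin_cases c <;> simp [chi, conj_cubeRoot, Fin.sum_univ_three] <;> grind

/-- The characters of the configuration space. -/
noncomputable def character {n : ℕ} (k σ : Config n) : ℂ := ∏ v, chi (k v) (σ v)

variable {n : ℕ}

lemma character_comm (k σ : Config n) : character k σ = character σ k := by
  simp [character, chi_comm]

lemma character_zero_left (σ : Config n) : character 0 σ = 1 := by
  simp [character, chi_zero_left]

lemma normSq_character (k σ : Config n) : Complex.normSq (character k σ) = 1 := by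
  have h : (Complex.normSq (character k σ) : ℂ) = 1 := by
    rw [← Complex.mul_conj, character, map_prod, ← Finset.prod_mul_distrib]
    simp [chi_mul_conj]
  exact_mod_cast h

lemma sum_character_mul_conj (σ τ : Config n) :
    ∑ k, character k σ * (starRingEnd ℂ) (character k τ) = if σ = τ then 3 ^ n else 0 := by
  simp only [character, map_prod, ← Finset.prod_mul_distrib]
  have h := Finset.prod_univ_sum (fun _ : Fin n => (Finset.univ : Finset (Fin 3)))
    (fun v a => chi a (σ v) * (starRingEnd ℂ) (chi a (τ v)))
  rw [Fintype.piFinset_univ] at h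
  rw [← h]
  simp only [sum_chi_mul_conj]
  split_ifs with hst
  · subst hst; simp
  · obtain ⟨v, hv⟩ := Function.ne_iff.mp hst
    exact Finset.prod_eq_zero (Finset.mem_univ v) (by simp [hv])

lemma character_update (k σ : Config n) (v : Fin n) :
    character k (Function.update σ v (σ v + 1)) = cubeRoot ^ (k v).val * character k σ := by
  rw [character, character, ← Finset.mul_prod_erase _ _ (Finset.mem_univ v),
    ← Finset.mul_prod_erase (f := fun v => chi (k v) (σ v)) _ (Finset.mem_univ v)]
  simp only [Function.update_self, chi_add_one, mul_assoc]
  congr 2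
  refine Finset.prod_congr rfl fun w hw => ?_
  rw [Function.update_of_ne (Finset.ne_of_mem_erase hw)]

/-- Plancherel identity for finite combinations of conjugate characters. -/
lemma sum_normSq_sum_character (c : Config n → ℂ) :
    ∑ τ : Config n, Complex.normSq (∑ k, c k * (starRingEnd ℂ) (character k τ))
      = 3 ^ n * ∑ k, Complex.normSq (c k) := by
  have h : ((∑ τ : Config n, Complex.normSq (∑ k, c k * (starRingEnd ℂ) (character k τ)) : ℝ) : ℂ)
      = ((3 ^ n * ∑ k, Complex.normSq (c k) : ℝ) : ℂ) := by
    push_cast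
    simp only [← Complex.mul_conj, map_sum, map_mul, Complex.conj_conj, Finset.sum_mul_sum]
    rw [Finset.sum_comm, Finset.mul_sum]
    refine Finset.sum_congr rfl fun k _ => ?_
    rw [Finset.sum_comm]
    have key : ∀ l : Config n, ∑ τ : Config n, c k * (starRingEnd ℂ) (character k τ) *
        ((starRingEnd ℂ) (c l) * character l τ)
        = c k * (starRingEnd ℂ) (c l) * if l = k then 3 ^ n else 0 := by
      intro l
      rw [← sum_character_mul_conj, Finset.mul_sum]
      refine Finset.sum_congr rfl fun τ _ => ?_
      rw [character_comm k, character_comm l]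
      ring
    simp only [key]
    simp [mul_comm]
  exact_mod_cast h

/-- The action of the transition matrix on functions. -/
lemma sum_cyclicP_mul (p : ℝ) (g : Config n → ℂ) (σ : Config n) :
    ∑ ρ, (cyclicP n p σ ρ : ℂ) * g ρ = 1 / n * ∑ v : Fin n,
      ((1 - p) * g σ + p * g (Function.update σ v (σ v + 1))) := by
  simp only [cyclicP, Matrix.of_apply]
  push_cast
  simp only [mul_assoc, ← Finset.mul_sum, Finset.sum_mul]
  rw [Finset.sum_comm]
  congr 1
  refine Finset.sum_congr rfl fun v _ => ?_
  simp [add_mul, Finset.sum_add_distrib, apply_ite ((↑) : ℝ → ℂ)]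

lemma sum_cyclicP_pow_mul_of_eigen (p : ℝ) (g : Config n → ℂ) (lam : ℂ)
    (h : ∀ σ, ∑ ρ, (cyclicP n p σ ρ : ℂ) * g ρ = lam * g σ) (t : ℕ) (σ : Config n) :
    ∑ ρ, ((cyclicP n p ^ t) σ ρ : ℂ) * g ρ = lam ^ t * g σ := by
  induction t generalizing σ with
  | zero => simp [Matrix.one_apply, apply_ite ((↑) : ℝ → ℂ)]
  | succ t ih =>
    simp only [pow_succ' (cyclicP n p), Matrix.mul_apply]
    push_cast
    simp only [Finset.sum_mul]
    rw [Finset.sum_comm]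
    simp only [mul_assoc, ← Finset.mul_sum, ih]
    simp only [mul_left_comm _ (lam ^ t), ← Finset.mul_sum, h]
    ring

/-- The eigenvalue of the transition matrix at the character `k`. -/
noncomputable def eigenvalue (n : ℕ) (p : ℝ) (k : Config n) : ℂ :=
  1 / n * ∑ v : Fin n, ((1 - p) + p * cubeRoot ^ (k v).val)

lemma sum_cyclicP_mul_character (p : ℝ) (k σ : Config n) :
    ∑ ρ, (cyclicP n p σ ρ : ℂ) * character k ρ = eigenvalue n p k * character k σ := by
  rw [sum_cyclicP_mul, eigenvalue, mul_assoc, Finset.sum_mul]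
  simp only [character_update, add_mul, mul_assoc]

/-- Spectral decomposition of the transition probabilities. -/
lemma cyclicP_pow_apply (p : ℝ) (t : ℕ) (σ τ : Config n) :
    ((cyclicP n p ^ t) σ τ : ℂ) = 1 / 3 ^ n *
      ∑ k, eigenvalue n p k ^ t * character k σ * (starRingEnd ℂ) (character k τ) := by
  have h3 : (3 : ℂ) ^ n ≠ 0 := pow_ne_zero _ (by norm_num)
  have h : ∑ ρ, ((cyclicP n p ^ t) σ ρ : ℂ) *
      ∑ k, character k ρ * (starRingEnd ℂ) (character k τ)
      = ∑ k, eigenvalue n p k ^ t * character k σ * (starRingEnd ℂ) (character k τ) := by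
    simp only [Finset.mul_sum]
    rw [Finset.sum_comm]
    refine Finset.sum_congr rfl fun k _ => ?_
    rw [← sum_cyclicP_pow_mul_of_eigen p _ _ (sum_cyclicP_mul_character p k), Finset.sum_mul]
    simp only [mul_assoc]
  rw [← h]
  simp only [sum_character_mul_conj]
  simp
  field_simp

lemma eigenvalue_zero (hn : 0 < n) (p : ℝ) : eigenvalue n p 0 = 1 := by
  have : (n : ℂ) ≠ 0 := by exact_mod_cast hn.ne'
  simp [eigenvalue]
  field_simp

/-- The `L²` distance to the uniform distribution in terms of the eigenvalues. -/
lemma sum_sq_lawAt_sub_unif (hn : 0 < n) (p : ℝ) (σ : Config n) (t : ℕ) :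
    3 ^ n * ∑ τ, (lawAt n p σ t τ - unif n τ) ^ 2
      = ∑ k ∈ Finset.univ.erase (0 : Config n), Complex.normSq (eigenvalue n p k) ^ t := by
  set c : Config n → ℂ := fun k =>
    if k = 0 then 0 else eigenvalue n p k ^ t * character k σ with hc
  have hdiff : ∀ τ, ((lawAt n p σ t τ - unif n τ : ℝ) : ℂ)
      = 1 / 3 ^ n * ∑ k, c k * (starRingEnd ℂ) (character k τ) := by
    intro τ
    rw [lawAt, unif]
    push_cast
    rw [cyclicP_pow_apply, ← Finset.add_sum_erase _ _ (Finset.mem_univ (0 : Config n)),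
      ← Finset.add_sum_erase (f := fun k => c k * _) _ (Finset.mem_univ (0 : Config n)),
      eigenvalue_zero hn]
    have : ∑ k ∈ Finset.univ.erase (0 : Config n), c k * (starRingEnd ℂ) (character k τ)
        = ∑ k ∈ Finset.univ.erase (0 : Config n),
          eigenvalue n p k ^ t * character k σ * (starRingEnd ℂ) (character k τ) := by
      refine Finset.sum_congr rfl fun k hk => ?_
      simp [hc, Finset.ne_of_mem_erase hk]
    rw [this]
    simp [character_zero_left, hc]
    ring
  have hsq : ∀ τ, (lawAt n p σ t τ - unif n τ) ^ 2
      = (1 / 3 ^ n) ^ 2 * Complex.normSq (∑ k, c k * (starRingEnd ℂ) (character k τ)) := by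
    intro τ
    have := congrArg Complex.normSq (hdiff τ)
    rw [Complex.normSq_ofReal, Complex.normSq_mul] at this
    rw [pow_two, this]
    congr 1
    have h3 : (1 / 3 ^ n : ℂ) = ((1 / 3 ^ n : ℝ) : ℂ) := by push_cast; rfl
    rw [h3, Complex.normSq_ofReal, pow_two]
  simp only [hsq, ← Finset.mul_sum]
  rw [sum_normSq_sum_character, ← Finset.add_sum_erase _ _ (Finset.mem_univ (0 : Config n))]
  have hnorm : ∑ k ∈ Finset.univ.erase (0 : Config n), Complex.normSq (c k)
      = ∑ k ∈ Finset.univ.erase (0 : Config n), Complex.normSq (eigenvalue n p k) ^ t := by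
    refine Finset.sum_congr rfl fun k hk => ?_
    simp [hc, Finset.ne_of_mem_erase hk, normSq_character]
  rw [hnorm]
  simp [hc]
  field_simp

/-- The number of vertices at which a configuration does not vanish. -/
def weight (k : Config n) : ℕ := #{v | k v ≠ 0}

lemma normSq_eigenvalue_le (hn : 0 < n) {p : ℝ} (k : Config n) :
    Complex.normSq (eigenvalue n p k)
      ≤ 1 - 3 * p * (weight k / n) * (1 - p * (weight k / n)) := by
  have hre : ∑ v, (1 - cubeRoot ^ (k v).val).re = 3 / 2 * weight k := by
    have : ∀ a : Fin 3, (1 - cubeRoot ^ a.val).re = if a ≠ 0 then 3 / 2 else 0 := by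
      intro a
      fin_cases a <;> simp [cubeRoot_sq] <;> norm_num [cubeRoot]
    simp only [this, weight]
    rw [← Finset.sum_filter, Finset.sum_const, nsmul_eq_mul, mul_comm]
  have him : |∑ v, (1 - cubeRoot ^ (k v).val).im| ≤ √3 / 2 * weight k := by
    refine (Finset.abs_sum_le_sum_abs _ _).trans ?_
    have : ∀ a : Fin 3, |(1 - cubeRoot ^ a.val).im| = if a ≠ 0 then √3 / 2 else 0 := by
      intro a
      fin_cases a <;> simp [cubeRoot_sq]
      · simp [cubeRoot, abs_div]
      · positivity
    simp only [this, weight]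
    rw [← Finset.sum_filter, Finset.sum_const, nsmul_eq_mul, mul_comm]
  rw [← Complex.re_sum] at hre
  rw [← Complex.im_sum] at him
  set z : ℂ := ∑ v, (1 - cubeRoot ^ (k v).val) with hz
  have hlam : eigenvalue n p k = 1 - ((p / n : ℝ) : ℂ) * z := by
    have : (n : ℂ) ≠ 0 := by exact_mod_cast hn.ne'
    rw [eigenvalue, hz]
    simp only [Finset.sum_add_distrib, Finset.sum_sub_distrib, ← Finset.mul_sum]
    simp
    field_simp
    ring
  have him2 : z.im ^ 2 ≤ 3 / 4 * (weight k : ℝ) ^ 2 := by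
    have := pow_le_pow_left₀ (abs_nonneg _) him 2
    rw [sq_abs] at this
    nlinarith [sqrt_three_mul_self]
  rw [hlam, Complex.normSq_apply]
  simp only [Complex.sub_re, Complex.one_re, Complex.re_ofReal_mul, Complex.sub_im, Complex.one_im,
    Complex.im_ofReal_mul, hre]
  have := mul_le_mul_of_nonneg_left him2 (sq_nonneg (p / n))
  have e : p * ((weight k : ℝ) / n) = p / n * weight k := by ring
  have e' : 3 * p * ((weight k : ℝ) / n) = 3 * (p / n * weight k) := by ring
  rw [e, e']
  nlinarith

lemma sum_pow_weight (n : ℕ) (q : ℝ) : ∑ k : Config n, q ^ weight k = (1 + 2 * q) ^ n := by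
  have h := Finset.prod_univ_sum (fun _ : Fin n => (Finset.univ : Finset (Fin 3)))
    (fun _ a => if a ≠ 0 then q else 1)
  rw [Fintype.piFinset_univ] at h
  have hprod : ∀ k : Config n, q ^ weight k = ∏ v, if k v ≠ 0 then q else 1 := by
    intro k
    rw [← Finset.prod_filter, Finset.prod_const, weight]
  simp only [hprod, ← h]
  simp [Fin.sum_univ_three]
  ring

lemma card_weight_eq_le (hn : 0 < n) {m : ℕ} (hm : 0 < m) :
    (#{k : Config n | weight k = m} : ℝ)
      ≤ Real.exp (2 * m + m * (Real.log n - Real.log m)) := by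
  have hn' : (0 : ℝ) < n := by exact_mod_cast hn
  have hm' : (0 : ℝ) < m := by exact_mod_cast hm
  have hq : (0 : ℝ) < m / n := by positivity
  have h1 : (#{k : Config n | weight k = m} : ℝ) * (m / n : ℝ) ^ m ≤ Real.exp (2 * m) := by
    calc (#{k : Config n | weight k = m} : ℝ) * (m / n : ℝ) ^ m
        = ∑ k : Config n with weight k = m, (m / n : ℝ) ^ weight k := by
          rw [Finset.sum_congr rfl (g := fun _ => (m / n : ℝ) ^ m)
            (fun k hk => by rw [(Finset.mem_filter.mp hk).2])]
          simp
      _ ≤ ∑ k : Config n, (m / n : ℝ) ^ weight k :=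
          Finset.sum_le_sum_of_subset_of_nonneg (Finset.filter_subset _ _)
            fun k _ _ => by positivity
      _ = (1 + 2 * (m / n : ℝ)) ^ n := sum_pow_weight n _
      _ ≤ Real.exp (2 * (m / n : ℝ)) ^ n := by
          gcongr
          linarith [Real.add_one_le_exp (2 * (m / n : ℝ))]
      _ = Real.exp (2 * m) := by
          rw [← Real.exp_nat_mul]
          congr 1
          field_simp
  have h2 : (m / n : ℝ) ^ m = Real.exp (-(m * (Real.log n - Real.log m))) := by
    rw [← Real.exp_log hq, ← Real.exp_nat_mul, Real.log_div hm'.ne' hn'.ne']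
    congr 1
    ring
  rw [h2, Real.exp_neg, ← div_eq_mul_inv, div_le_iff₀ (Real.exp_pos _), ← Real.exp_add] at h1
  exact h1

lemma mul_log_le (hn : 0 < n) {m : ℕ} (hm : 0 < m) (hmn : m ≤ n) :
    (m : ℝ) / n * Real.log n ≤ 1 + Real.log m := by
  have hn' : (0 : ℝ) < n := by exact_mod_cast hn
  have hm' : (1 : ℝ) ≤ m := by exact_mod_cast hm
  have hmn' : (m : ℝ) ≤ n := by exact_mod_cast hmn
  have h := Real.log_le_sub_one_of_pos (x := (n : ℝ) / m) (by positivity)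
  rw [Real.log_div hn'.ne' (by positivity)] at h
  have hx : (m : ℝ) / n ≤ 1 := (div_le_one hn').mpr hmn'
  have hx0 : 0 ≤ (m : ℝ) / n := by positivity
  have h2 := mul_le_mul_of_nonneg_left h hx0
  have h3 : (m : ℝ) / n * (n / m - 1) = 1 - m / n := by field_simp
  nlinarith [Real.log_nonneg hm']

/-- The contribution to the `L²` distance of the characters of weight `m`. -/
lemma card_mul_pow_le {p : ℝ} (hp0 : 0 < p) (hp1 : p < 1) {α : ℝ} (hα : 0 ≤ α)
    (hn : 0 < n) {m : ℕ} (hm : 0 < m) (hmn : m ≤ n) :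
    (#{k : Config n | weight k = m} : ℝ) * (1 - 3 * p * (m / n) * (1 - p * (m / n))) ^
        ⌊1 / (3 * p) * n * Real.log n + α * n⌋₊
      ≤ Real.exp (6 - 3 * p * (1 - p) * α) ^ m := by
  have hn' : (0 : ℝ) < n := by exact_mod_cast hn
  have hm' : (1 : ℝ) ≤ m := by exact_mod_cast hm
  have hx : (m : ℝ) / n ≤ 1 := (div_le_one hn').mpr (by exact_mod_cast hmn)
  have hx0 : 0 ≤ (m : ℝ) / n := by positivity
  have hlog := mul_log_le hn hm hmn
  have hlogn : 0 ≤ Real.log n := Real.log_natCast_nonneg n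
  have hmx : (m : ℝ) = m / n * n := by field_simp
  set x : ℝ := (m : ℝ) / n with hxdef
  set t := ⌊1 / (3 * p) * n * Real.log n + α * n⌋₊ with ht
  have htl : 1 / (3 * p) * n * Real.log n + α * n - 1 ≤ t := (Nat.sub_one_lt_floor _).le
  have hpx : p * x ≤ p := by nlinarith
  have hpx0 : 0 ≤ p * x := by positivity
  have hy0 : 0 ≤ 3 * p * x * (1 - p * x) := by nlinarith
  have hb0 : 0 ≤ 1 - 3 * p * x * (1 - p * x) := by nlinarith [sq_nonneg (p * x - 1 / 2)]
  have hb : (1 - 3 * p * x * (1 - p * x)) ^ t ≤ Real.exp (-(t * (3 * p * x * (1 - p * x)))) := by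
    calc (1 - 3 * p * x * (1 - p * x)) ^ t ≤ Real.exp (-(3 * p * x * (1 - p * x))) ^ t := by
          gcongr
          linarith [Real.add_one_le_exp (-(3 * p * x * (1 - p * x)))]
      _ = _ := by rw [← Real.exp_nat_mul]; congr 1; ring
  refine (mul_le_mul (card_weight_eq_le hn hm) hb (pow_nonneg hb0 _) (Real.exp_pos _).le).trans ?_
  rw [← Real.exp_add, ← Real.exp_nat_mul, Real.exp_le_exp]
  have h1 := mul_le_mul_of_nonneg_right htl hy0
  have h2 : (1 / (3 * p) * n * Real.log n + α * n - 1) * (3 * p * x * (1 - p * x))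
      = (1 - p * x) * (m * Real.log n) + (1 - p * x) * (3 * p * α * m)
        - 3 * (p * x) * (1 - p * x) := by
    rw [hmx]
    field_simp
  have h3 : 3 * (p * x) * (1 - p * x) ≤ 3 * m := by nlinarith
  have h4 : (1 - p) * (3 * p * α * m) ≤ (1 - p * x) * (3 * p * α * m) := by
    have : 0 ≤ 3 * p * α * m := by positivity
    nlinarith
  have h5 : p * (x * Real.log n) ≤ 1 + Real.log m := by
    have : 0 ≤ x * Real.log n := by positivity
    nlinarith
  have h6 := mul_le_mul_of_nonneg_left h5 (by linarith : (0 : ℝ) ≤ m)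
  nlinarith

lemma sum_Icc_one_pow_le {r : ℝ} (hr0 : 0 ≤ r) (hr1 : r < 1) (n : ℕ) :
    ∑ m ∈ Finset.Icc 1 n, r ^ m ≤ r / (1 - r) := by
  have h : ∑ m ∈ Finset.Icc 1 n, r ^ m = (r - r ^ (n + 1)) / (1 - r) := by
    have : 1 - r ≠ 0 := by linarith
    induction n with
    | zero => simp
    | succ n ih =>
      rw [Finset.sum_Icc_succ_top (by omega), ih]
      field_simp
      ring
  rw [h]
  have : 0 < 1 - r := by linarith
  gcongr
  linarith [pow_nonneg hr0 (n + 1)]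

lemma weight_mem_Icc {k : Config n} (hk : k ≠ 0) : weight k ∈ Finset.Icc 1 n := by
  obtain ⟨v, hv⟩ := Function.ne_iff.mp hk
  rw [Finset.mem_Icc]
  refine ⟨Finset.card_pos.mpr ⟨v, by simpa using hv⟩, ?_⟩
  simpa [weight] using Finset.card_le_univ (Finset.univ.filter fun v => k v ≠ 0)

lemma sum_normSq_eigenvalue_pow_le {p : ℝ} (hp0 : 0 < p) (hp1 : p < 1) {α : ℝ} (hα : 0 ≤ α)
    (hn : 0 < n) (hr : Real.exp (6 - 3 * p * (1 - p) * α) < 1) :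
    ∑ k ∈ Finset.univ.erase (0 : Config n), Complex.normSq (eigenvalue n p k) ^
        ⌊1 / (3 * p) * n * Real.log n + α * n⌋₊
      ≤ Real.exp (6 - 3 * p * (1 - p) * α) / (1 - Real.exp (6 - 3 * p * (1 - p) * α)) := by
  refine le_trans ?_ (sum_Icc_one_pow_le (Real.exp_pos _).le hr n)
  rw [← Finset.sum_fiberwise_of_maps_to
    (fun k hk => weight_mem_Icc (Finset.ne_of_mem_erase hk))]
  refine Finset.sum_le_sum fun m hm => ?_
  rw [Finset.mem_Icc] at hm
  refine le_trans ?_ (card_mul_pow_le hp0 hp1 hα hn (by omega) hm.2)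
  set t := ⌊1 / (3 * p) * n * Real.log n + α * n⌋₊
  calc _ ≤ ∑ k : Config n with weight k = m, Complex.normSq (eigenvalue n p k) ^ t :=
        Finset.sum_le_sum_of_subset_of_nonneg
          (Finset.filter_subset_filter _ (Finset.erase_subset _ _))
          fun k _ _ => pow_nonneg (Complex.normSq_nonneg _) _
    _ ≤ ∑ k : Config n with weight k = m, (1 - 3 * p * (m / n) * (1 - p * (m / n))) ^ t := by
        refine Finset.sum_le_sum fun k hk => ?_
        have := normSq_eigenvalue_le hn (p := p) k
        rw [(Finset.mem_filter.mp hk).2] at this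
        exact pow_le_pow_left₀ (Complex.normSq_nonneg _) this _
    _ = _ := by simp

/-- Total variation is bounded by the `L²` distance. -/
lemma tvDist_le_sqrt {X : Type*} [Fintype X] (μ ν : X → ℝ) :
    tvDist μ ν ≤ √(Fintype.card X * ∑ x, (μ x - ν x) ^ 2) := by
  refine ciSup_le fun A => ?_
  rw [← Finset.sum_sub_distrib]
  apply Real.abs_le_sqrt
  calc (∑ x ∈ A, (μ x - ν x)) ^ 2 ≤ #A * ∑ x ∈ A, (μ x - ν x) ^ 2 := sq_sum_le_card_mul_sum_sq
    _ ≤ Fintype.card X * ∑ x, (μ x - ν x) ^ 2 := by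
        gcongr
        · exact Finset.card_le_univ A
        · exact Finset.subset_univ A

lemma dmax_le_of_nonneg {p : ℝ} (hp0 : 0 < p) (hp1 : p < 1) {α : ℝ} (hα : 0 ≤ α)
    (hn : 0 < n) (hr : Real.exp (6 - 3 * p * (1 - p) * α) < 1) :
    dmax n p ⌊1 / (3 * p) * n * Real.log n + α * n⌋₊ ≤
      √(Real.exp (6 - 3 * p * (1 - p) * α) / (1 - Real.exp (6 - 3 * p * (1 - p) * α))) := by
  refine ciSup_le fun σ => (tvDist_le_sqrt _ _).trans (Real.sqrt_le_sqrt ?_)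
  have hcard : (Fintype.card (Config n) : ℝ) = 3 ^ n := by simp
  rw [hcard, sum_sq_lawAt_sub_unif hn]
  exact sum_normSq_eigenvalue_pow_le hp0 hp1 hα hn hr

/-- The sum of the colors, read as cube roots of unity. -/
noncomputable def colorSum (σ : Config n) : ℂ := ∑ v, chi 1 (σ v)

lemma colorSum_update (σ : Config n) (v : Fin n) :
    colorSum (Function.update σ v (σ v + 1)) = colorSum σ + (cubeRoot - 1) * chi 1 (σ v) := by
  rw [colorSum, colorSum, ← Finset.add_sum_erase _ _ (Finset.mem_univ v),
    ← Finset.add_sum_erase (f := fun v => chi 1 (σ v)) _ (Finset.mem_univ v)]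
  have h : ∑ w ∈ Finset.univ.erase v, chi 1 (Function.update σ v (σ v + 1) w)
      = ∑ w ∈ Finset.univ.erase v, chi 1 (σ w) :=
    Finset.sum_congr rfl fun w hw => by
      rw [Function.update_of_ne (Finset.ne_of_mem_erase hw)]
  rw [h, Function.update_self, chi_add_one]
  simp
  ring

lemma colorSum_zero : colorSum (0 : Config n) = n := by
  simp [colorSum, chi]

lemma sum_cyclicP_mul_colorSum (hn : 0 < n) (p : ℝ) (σ : Config n) :
    ∑ ρ, (cyclicP n p σ ρ : ℂ) * colorSum ρ = (1 + p / n * (cubeRoot - 1)) * colorSum σ := by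
  have hn' : (n : ℂ) ≠ 0 := by exact_mod_cast hn.ne'
  rw [sum_cyclicP_mul]
  simp only [colorSum_update, mul_add, Finset.sum_add_distrib, ← Finset.mul_sum]
  rw [← colorSum]
  simp
  field_simp
  ring

/-- The centered squared modulus of `colorSum`. -/
noncomputable def colorSumSq (σ : Config n) : ℂ :=
  colorSum σ * (starRingEnd ℂ) (colorSum σ) - n

lemma colorSumSq_update (σ : Config n) (v : Fin n) :
    colorSumSq (Function.update σ v (σ v + 1)) = colorSumSq σ + 3
      + (cubeRoot - 1) * (starRingEnd ℂ) (colorSum σ) * chi 1 (σ v)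
      + (-2 - cubeRoot) * colorSum σ * (starRingEnd ℂ) (chi 1 (σ v)) := by
  rw [colorSumSq, colorSumSq, colorSum_update]
  simp only [map_add, map_mul, map_sub, map_one, conj_cubeRoot]
  linear_combination (cubeRoot - 1) * (-2 - cubeRoot) * chi_mul_conj 1 (σ v) - cubeRoot_sq_eq

lemma sum_cyclicP_mul_colorSumSq (hn : 0 < n) (p : ℝ) (σ : Config n) :
    ∑ ρ, (cyclicP n p σ ρ : ℂ) * colorSumSq ρ = (1 - 3 * p / n : ℝ) * colorSumSq σ := by
  have hn' : (n : ℂ) ≠ 0 := by exact_mod_cast hn.ne'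
  rw [sum_cyclicP_mul]
  simp only [colorSumSq_update, mul_add, Finset.sum_add_distrib, ← Finset.mul_sum]
  rw [← map_sum, ← colorSum]
  simp only [colorSumSq, Finset.sum_const, Finset.card_univ, Fintype.card_fin, nsmul_eq_mul]
  push_cast
  field_simp
  ring

lemma sum_comp_update (g : Config n → ℂ) (v : Fin n) :
    ∑ σ : Config n, g (Function.update σ v (σ v + 1)) = ∑ σ, g σ := by
  rw [← Equiv.sum_comp (Equiv.addRight (Pi.single v 1 : Config n)) g]
  refine Finset.sum_congr rfl fun σ _ => congrArg g ?_
  ext w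
  by_cases hw : w = v
  · subst hw; simp
  · simp [hw]

lemma sum_colorSumSq (hn : 0 < n) : ∑ σ : Config n, colorSumSq σ = 0 := by
  have hn' : (n : ℂ) ≠ 0 := by exact_mod_cast hn.ne'
  have h1 : ∑ σ : Config n, ∑ ρ, (cyclicP n 1 σ ρ : ℂ) * colorSumSq ρ
      = ∑ σ : Config n, colorSumSq σ := by
    simp only [sum_cyclicP_mul, ← Finset.mul_sum]
    rw [Finset.sum_comm]
    simp [sum_comp_update]
    field_simp
  simp only [sum_cyclicP_mul_colorSumSq hn, ← Finset.mul_sum] at h1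
  push_cast at h1
  field_simp at h1
  have h2 : (3 : ℂ) * ∑ σ : Config n, colorSumSq σ = 0 := by linear_combination -h1
  simpa using h2

lemma sum_lawAt (hn : 0 < n) (p : ℝ) (σ : Config n) (t : ℕ) : ∑ τ, lawAt n p σ t τ = 1 := by
  have hn' : (n : ℂ) ≠ 0 := by exact_mod_cast hn.ne'
  have h := sum_cyclicP_pow_mul_of_eigen p (fun _ : Config n => 1) 1
    (fun σ => by rw [sum_cyclicP_mul]; simp; field_simp) t σ
  simp only [mul_one, one_pow] at h
  exact_mod_cast h

lemma lawAt_nonneg {p : ℝ} (hp0 : 0 < p) (hp1 : p < 1) (σ τ : Config n) (t : ℕ) :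
    0 ≤ lawAt n p σ t τ := by
  rw [lawAt]
  induction t generalizing σ with
  | zero =>
    rw [pow_zero, Matrix.one_apply]
    split_ifs <;> norm_num
  | succ t ih =>
    rw [pow_succ', Matrix.mul_apply]
    refine Finset.sum_nonneg fun ρ _ => mul_nonneg ?_ (ih ρ)
    rw [cyclicP, Matrix.of_apply]
    have : 0 ≤ 1 - p := by linarith
    refine mul_nonneg (by positivity) (Finset.sum_nonneg fun v _ => ?_)
    split_ifs <;> simp <;> linarith

lemma sum_unif (n : ℕ) : ∑ τ, unif n τ = 1 := by
  simp [unif]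

lemma le_tvDist {X : Type*} [Fintype X] (μ ν : X → ℝ) (A : Finset X) :
    |∑ x ∈ A, μ x - ∑ x ∈ A, ν x| ≤ tvDist μ ν :=
  le_ciSup (f := fun A : Finset X => |∑ x ∈ A, μ x - ∑ x ∈ A, ν x|)
    (Set.finite_range _).bddAbove A

lemma le_dmax (p : ℝ) (t : ℕ) (σ : Config n) : tvDist (lawAt n p σ t) (unif n) ≤ dmax n p t :=
  le_ciSup (f := fun σ : Config n => tvDist (lawAt n p σ t) (unif n))
    (Set.finite_range _).bddAbove σ

lemma dmax_nonneg (n : ℕ) (p : ℝ) (t : ℕ) : 0 ≤ dmax n p t :=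
  ((abs_nonneg _).trans (le_tvDist _ _ ∅)).trans (le_dmax p t 0)

lemma dmax_le_one (hn : 0 < n) {p : ℝ} (hp0 : 0 < p) (hp1 : p < 1) (t : ℕ) :
    dmax n p t ≤ 1 := by
  refine ciSup_le fun σ => ciSup_le fun A => ?_
  have hL : ∑ x ∈ A, lawAt n p σ t x ≤ 1 := by
    rw [← sum_lawAt hn p σ t]
    exact Finset.sum_le_sum_of_subset_of_nonneg (Finset.subset_univ _)
      fun x _ _ => lawAt_nonneg hp0 hp1 _ _ _
  have hL0 : 0 ≤ ∑ x ∈ A, lawAt n p σ t x :=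
    Finset.sum_nonneg fun x _ => lawAt_nonneg hp0 hp1 _ _ _
  have hU : ∑ x ∈ A, unif n x ≤ 1 := by
    rw [← sum_unif n]
    exact Finset.sum_le_sum_of_subset_of_nonneg (Finset.subset_univ _)
      fun x _ _ => by rw [unif]; positivity
  have hU0 : 0 ≤ ∑ x ∈ A, unif n x := Finset.sum_nonneg fun x _ => by rw [unif]; positivity
  rw [abs_le]
  constructor <;> linarith

/-- Markov's inequality for a finite sum. -/
lemma sum_filter_mul_le {X : Type*} [Fintype X] (w g : X → ℝ) (hw : ∀ x, 0 ≤ w x)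
    (hg : ∀ x, 0 ≤ g x) (P : X → Prop) [DecidablePred P] {c : ℝ} (hc : ∀ x, P x → c ≤ g x) :
    (∑ x with P x, w x) * c ≤ ∑ x, w x * g x := by
  rw [Finset.sum_mul]
  calc ∑ x with P x, w x * c ≤ ∑ x with P x, w x * g x :=
        Finset.sum_le_sum fun x hx =>
          mul_le_mul_of_nonneg_left (hc x (Finset.mem_filter.mp hx).2) (hw x)
    _ ≤ _ := Finset.sum_le_sum_of_subset_of_nonneg (Finset.filter_subset _ _)
        fun x _ _ => mul_nonneg (hw x) (hg x)

lemma sum_unif_mul_normSq (hn : 0 < n) :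
    ∑ τ, unif n τ * Complex.normSq (colorSum τ) = n := by
  have h := sum_colorSumSq hn
  simp only [colorSumSq, Complex.mul_conj, Finset.sum_sub_distrib] at h
  simp at h
  have h' : ∑ τ : Config n, Complex.normSq (colorSum τ) = 3 ^ n * n := by
    have : ((∑ τ : Config n, Complex.normSq (colorSum τ) : ℝ) : ℂ) = ((3 ^ n * n : ℝ) : ℂ) := by
      push_cast
      linear_combination h
    exact_mod_cast this
  simp only [unif, ← Finset.mul_sum, h']
  field_simp

lemma normSq_one_add (p : ℝ) (n : ℕ) :
    Complex.normSq (1 + p / n * (cubeRoot - 1)) = 1 - 3 * p / n + 3 * (p / n) ^ 2 := by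
  have h : (1 + p / n * (cubeRoot - 1) : ℂ) = 1 + ((p / n : ℝ) : ℂ) * (cubeRoot - 1) := by
    push_cast; rfl
  rw [h, Complex.normSq_apply]
  simp only [Complex.add_re, Complex.one_re, Complex.re_ofReal_mul, Complex.add_im, Complex.one_im,
    Complex.im_ofReal_mul, Complex.sub_re, Complex.sub_im, cubeRoot]
  linear_combination (p / n) ^ 2 / 4 * sqrt_three_mul_self

/-- The variance of `colorSum` under the law at time `t` is at most `n`. -/
lemma sum_lawAt_mul_normSq_sub_le {p : ℝ} (hn : 0 < n) (hpn : 3 * p / n ≤ 1) (t : ℕ) :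
    ∑ τ, lawAt n p 0 t τ *
      Complex.normSq (colorSum τ - n * (1 + p / n * (cubeRoot - 1)) ^ t) ≤ n := by
  set lam : ℂ := 1 + p / n * (cubeRoot - 1) with hlam
  set M : ℂ := n * lam ^ t with hM
  have hmean : ∑ τ, (lawAt n p 0 t τ : ℂ) * colorSum τ = M := by
    have h := sum_cyclicP_pow_mul_of_eigen p _ _ (sum_cyclicP_mul_colorSum hn p) t 0
    rw [colorSum_zero] at h
    rw [hM, mul_comm]
    exact h
  have hmean' : ∑ τ, (lawAt n p 0 t τ : ℂ) * (starRingEnd ℂ) (colorSum τ)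
      = (starRingEnd ℂ) M := by
    rw [← hmean, map_sum]
    simp
  have hone : ∑ τ, (lawAt n p 0 t τ : ℂ) = 1 := by exact_mod_cast sum_lawAt hn p 0 t
  have hsq : ∑ τ, (lawAt n p 0 t τ : ℂ) * (colorSum τ * (starRingEnd ℂ) (colorSum τ))
      = n + (1 - 3 * p / n : ℝ) ^ t * (n ^ 2 - n) := by
    have h := sum_cyclicP_pow_mul_of_eigen p _ _ (sum_cyclicP_mul_colorSumSq hn p) t 0
    change ∑ τ, (lawAt n p 0 t τ : ℂ) * colorSumSq τ = _ at h
    simp only [colorSumSq, mul_sub, Finset.sum_sub_distrib, ← Finset.sum_mul, hone,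
      colorSum_zero] at h
    simp only [Complex.conj_natCast] at h
    linear_combination h
  have hvar : ∑ τ, lawAt n p 0 t τ * Complex.normSq (colorSum τ - M)
      = n + (1 - 3 * p / n) ^ t * (n ^ 2 - n) - Complex.normSq M := by
    have : ((∑ τ, lawAt n p 0 t τ * Complex.normSq (colorSum τ - M) : ℝ) : ℂ)
        = ((n + (1 - 3 * p / n) ^ t * (n ^ 2 - n) - Complex.normSq M : ℝ) : ℂ) := by
      push_cast
      simp only [← Complex.mul_conj, map_sub]
      have expand : ∀ τ, (lawAt n p 0 t τ : ℂ) *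
          ((colorSum τ - M) * ((starRingEnd ℂ) (colorSum τ) - (starRingEnd ℂ) M))
          = (lawAt n p 0 t τ : ℂ) * (colorSum τ * (starRingEnd ℂ) (colorSum τ))
            - (lawAt n p 0 t τ : ℂ) * colorSum τ * (starRingEnd ℂ) M
            - (lawAt n p 0 t τ : ℂ) * (starRingEnd ℂ) (colorSum τ) * M
            + (lawAt n p 0 t τ : ℂ) * (M * (starRingEnd ℂ) M) := fun τ => by ring
      simp only [expand, Finset.sum_add_distrib, Finset.sum_sub_distrib, ← Finset.sum_mul, hmean,
        hmean', hone, hsq]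
      push_cast
      ring
    exact_mod_cast this
  have hMsq : Complex.normSq M = n ^ 2 * (1 - 3 * p / n + 3 * (p / n) ^ 2) ^ t := by
    rw [hM, Complex.normSq_mul, map_pow, hlam, normSq_one_add, Complex.normSq_natCast]
    ring
  rw [hvar, hMsq]
  have h0 : 0 ≤ 1 - 3 * p / n := by linarith
  have hle : (1 - 3 * p / n) ^ t ≤ (1 - 3 * p / n + 3 * (p / n) ^ 2) ^ t :=
    pow_le_pow_left₀ h0 (by nlinarith [sq_nonneg (p / n)]) t
  have hpow : 0 ≤ (1 - 3 * p / n) ^ t := pow_nonneg h0 t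
  have hn0 : (0 : ℝ) ≤ n := Nat.cast_nonneg n
  nlinarith [mul_nonneg hpow hn0, mul_le_mul_of_nonneg_left hle (sq_nonneg (n : ℝ))]

/-- Lower bound on the distance to stationarity by the second moment method. -/
lemma one_sub_le_dmax {p : ℝ} (hp0 : 0 < p) (hp1 : p < 1) (hn : 0 < n) (hpn : 3 * p / n < 1)
    (t : ℕ) : 1 - 8 / (n * (1 - 3 * p / n) ^ t) ≤ dmax n p t := by
  classical
  have hn' : (0 : ℝ) < n := by exact_mod_cast hn
  set lam : ℂ := 1 + p / n * (cubeRoot - 1) with hlam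
  set M : ℂ := n * lam ^ t with hM
  have h0 : 0 < 1 - 3 * p / n := by linarith
  have hMsq : n ^ 2 * (1 - 3 * p / n) ^ t ≤ ‖M‖ ^ 2 := by
    rw [← Complex.normSq_eq_norm_sq, hM, Complex.normSq_mul, map_pow, hlam, normSq_one_add,
      Complex.normSq_natCast, pow_two]
    gcongr
    nlinarith [sq_nonneg (p / n)]
  have hMpos : 0 < n ^ 2 * (1 - 3 * p / n) ^ t := by positivity
  have hU := sum_filter_mul_le (unif n) (fun τ => Complex.normSq (colorSum τ))
    (fun _ => by rw [unif]; positivity) (fun _ => Complex.normSq_nonneg _)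
    (fun τ => ‖M‖ / 2 ≤ ‖colorSum τ‖) (c := (‖M‖ / 2) ^ 2) (fun τ h => by
      rw [Complex.normSq_eq_norm_sq]; gcongr)
  rw [sum_unif_mul_normSq hn] at hU
  have hL := sum_filter_mul_le (lawAt n p 0 t) (fun τ => Complex.normSq (colorSum τ - M))
    (fun _ => lawAt_nonneg hp0 hp1 _ _ _) (fun _ => Complex.normSq_nonneg _)
    (fun τ => ¬ ‖M‖ / 2 ≤ ‖colorSum τ‖) (c := (‖M‖ / 2) ^ 2) (fun τ h => by
      rw [Complex.normSq_eq_norm_sq]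
      gcongr
      have := norm_sub_norm_le M (colorSum τ)
      rw [norm_sub_rev] at this
      linarith)
  replace hL := hL.trans (sum_lawAt_mul_normSq_sub_le hn hpn.le t)
  have hsplit := Finset.sum_filter_add_sum_filter_not Finset.univ
    (fun τ : Config n => ‖M‖ / 2 ≤ ‖colorSum τ‖) (lawAt n p 0 t)
  rw [sum_lawAt hn] at hsplit
  have hTV := (le_abs_self _).trans ((le_tvDist (lawAt n p 0 t) (unif n)
    (Finset.univ.filter fun τ => ‖M‖ / 2 ≤ ‖colorSum τ‖)).trans (le_dmax p t 0))
  set a := ∑ τ with ‖M‖ / 2 ≤ ‖colorSum τ‖, unif n τ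
  set b := ∑ τ with ¬ ‖M‖ / 2 ≤ ‖colorSum τ‖, lawAt n p 0 t τ
  have hM2 : 0 < (‖M‖ / 2) ^ 2 := by nlinarith
  have hbound : ∀ c : ℝ, c * (‖M‖ / 2) ^ 2 ≤ n → c ≤ 4 / (n * (1 - 3 * p / n) ^ t) := by
    intro c hc
    rw [← le_div_iff₀ hM2] at hc
    refine hc.trans ?_
    rw [div_le_div_iff₀ hM2 (by positivity)]
    nlinarith
  have ha := hbound a hU
  have hb := hbound b hL
  have : 8 / (n * (1 - 3 * p / n) ^ t) = 2 * (4 / (n * (1 - 3 * p / n) ^ t)) := by ring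
  linarith

lemma exp_le_mul_pow {p : ℝ} (hp0 : 0 < p) (hp1 : p < 1) {α : ℝ} (hα : α ≤ 0) (hn : 6 ≤ n)
    (hlog : -(3 * p * α) ≤ Real.log n) :
    Real.exp (-(3 * p * α) - 6) ≤
      n * (1 - 3 * p / n) ^ ⌊1 / (3 * p) * n * Real.log n + α * n⌋₊ := by
  have hn6 : (6 : ℝ) ≤ n := by exact_mod_cast hn
  have hn' : (0 : ℝ) < n := by linarith
  have hT : 1 / (3 * p) * n * Real.log n + α * n = n / (3 * p) * (Real.log n + 3 * p * α) := by
    field_simp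
  have hT0 : 0 ≤ 1 / (3 * p) * n * Real.log n + α * n := by
    rw [hT]
    exact mul_nonneg (by positivity) (by linarith)
  have ht := Nat.floor_le hT0
  set t := ⌊1 / (3 * p) * n * Real.log n + α * n⌋₊
  set y := 3 * p / n with hy
  have hy0 : 0 < y := by positivity
  have hy1 : y ≤ 1 / 2 := by
    rw [hy, div_le_iff₀ hn']
    linarith
  have hty : t * y ≤ Real.log n + 3 * p * α := by
    rw [hT] at ht
    calc t * y ≤ n / (3 * p) * (Real.log n + 3 * p * α) * y := by gcongr
      _ = _ := by rw [hy]; field_simp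
  have hylog : y * Real.log n ≤ 3 := by
    have h1 := Real.log_le_sub_one_of_pos hn'
    calc y * Real.log n ≤ y * n := by gcongr; linarith
      _ = 3 * p := by rw [hy]; field_simp
      _ ≤ 3 := by linarith
  have hlog1 : -(y + 2 * y ^ 2) ≤ Real.log (1 - y) := by
    refine le_trans ?_ (Real.one_sub_inv_le_log_of_pos (by linarith : 0 < 1 - y))
    have hinv : (1 - y)⁻¹ ≤ 1 + (y + 2 * y ^ 2) := by
      rw [inv_le_iff_one_le_mul₀ (by linarith)]
      nlinarith [sq_nonneg y, mul_nonneg (sq_nonneg y) (by linarith : 0 ≤ 1 - 2 * y)]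
    linarith
  have heq : n * (1 - y) ^ t = Real.exp (Real.log n + t * Real.log (1 - y)) := by
    rw [Real.exp_add, Real.exp_log hn', Real.exp_nat_mul, Real.exp_log (by linarith)]
  rw [heq, Real.exp_le_exp]
  have h1 := mul_le_mul_of_nonneg_left hlog1 (Nat.cast_nonneg (α := ℝ) t)
  have h2 := mul_le_mul_of_nonneg_left hty hy0.le
  have h3 : y * (3 * p * α) ≤ 0 :=
    mul_nonpos_of_nonneg_of_nonpos hy0.le (mul_nonpos_of_nonneg_of_nonpos (by positivity) hα)
  nlinarith

lemma eventually_le_dmax {p : ℝ} (hp0 : 0 < p) (hp1 : p < 1) {α : ℝ} (hα : α ≤ 0) :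
    ∀ᶠ n : ℕ in atTop, 1 - 8 * Real.exp (3 * p * α + 6) ≤
      dmax n p ⌊1 / (3 * p) * n * Real.log n + α * n⌋₊ := by
  have hlog : ∀ᶠ n : ℕ in atTop, -(3 * p * α) ≤ Real.log n :=
    (Real.tendsto_log_atTop.comp tendsto_natCast_atTop_atTop).eventually_ge_atTop _
  filter_upwards [hlog, eventually_ge_atTop 6] with n hn hn6
  have hn6' : (6 : ℝ) ≤ n := by exact_mod_cast hn6
  have hpn : 3 * p / n < 1 := by
    rw [div_lt_one (by linarith)]
    linarith
  refine le_trans ?_ (one_sub_le_dmax hp0 hp1 (by omega) hpn _)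
  have h := exp_le_mul_pow hp0 hp1 hα hn6 hn
  have h8 := div_le_div_of_nonneg_left (by norm_num : (0 : ℝ) ≤ 8) (Real.exp_pos _) h
  have he : 8 / Real.exp (-(3 * p * α) - 6) = 8 * Real.exp (3 * p * α + 6) := by
    rw [div_eq_mul_inv, ← Real.exp_neg]
    congr 2
    ring
  linarith

end CyclicDynamics

open CyclicDynamics

/-- the cyclic dynamics with parameter `p ∈ (0,1)` exhibits cutoff
at `t(n) = (1/(3p)) n log n` with window of size `O(n)`. -/
theorem cyclic_dynamics_cutoff (p : ℝ) (hp0 : 0 < p) (hp1 : p < 1) :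
    Tendsto (fun α : ℝ => liminf (fun n : ℕ =>
        dmax n p ⌊1 / (3 * p) * n * Real.log n + α * n⌋₊) atTop) atBot (nhds 1)
    ∧ Tendsto (fun α : ℝ => limsup (fun n : ℕ =>
        dmax n p ⌊1 / (3 * p) * n * Real.log n + α * n⌋₊) atTop) atTop (nhds 0) := by
  have hle1 : ∀ α : ℝ, ∀ᶠ n : ℕ in atTop,
      dmax n p ⌊1 / (3 * p) * n * Real.log n + α * n⌋₊ ≤ 1 := fun α => by
    filter_upwards [eventually_gt_atTop 0] with n hn
    exact dmax_le_one hn hp0 hp1 _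
  have hge0 : ∀ α : ℝ, ∀ᶠ n : ℕ in atTop,
      0 ≤ dmax n p ⌊1 / (3 * p) * n * Real.log n + α * n⌋₊ := fun α =>
    Eventually.of_forall fun n => dmax_nonneg n p _
  constructor
  · have hlim : Tendsto (fun α : ℝ => 1 - 8 * Real.exp (3 * p * α + 6)) atBot (nhds 1) := by
      have hlin : Tendsto (fun α : ℝ => 3 * p * α + 6) atBot atBot :=
        tendsto_atBot_add_const_right _ _ (tendsto_id.const_mul_atBot (by positivity))
      simpa using ((Real.tendsto_exp_atBot.comp hlin).const_mul 8).const_sub 1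
    refine tendsto_of_tendsto_of_tendsto_of_le_of_le' hlim tendsto_const_nhds ?_ ?_
    · filter_upwards [eventually_le_atBot 0] with α hα
      exact le_liminf_of_le (isBoundedUnder_of_eventually_le (hle1 α)).isCoboundedUnder_ge
        (eventually_le_dmax hp0 hp1 hα)
    · refine Eventually.of_forall fun α => ?_
      exact liminf_le_of_frequently_le (hle1 α).frequently
        (isBoundedUnder_of_eventually_ge (hge0 α))
  · have hexp : Tendsto (fun α : ℝ => Real.exp (6 - 3 * p * (1 - p) * α)) atTop (nhds 0) := by
      have hc : 0 < 3 * p * (1 - p) := mul_pos (by positivity) (by linarith)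
      refine Real.tendsto_exp_atBot.comp ?_
      simp only [sub_eq_add_neg (6 : ℝ)]
      exact tendsto_atBot_add_const_left _ _
        (tendsto_neg_atTop_atBot.comp (tendsto_id.const_mul_atTop hc))
    have hlim : Tendsto (fun α : ℝ => √(Real.exp (6 - 3 * p * (1 - p) * α) /
        (1 - Real.exp (6 - 3 * p * (1 - p) * α)))) atTop (nhds 0) := by
      simpa using (hexp.div (hexp.const_sub 1) (by norm_num)).sqrt
    refine tendsto_of_tendsto_of_tendsto_of_le_of_le' tendsto_const_nhds hlim ?_ ?_
    · refine Eventually.of_forall fun α => ?_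
      exact le_limsup_of_frequently_le (hge0 α).frequently
        (isBoundedUnder_of_eventually_le (hle1 α))
    · filter_upwards [eventually_ge_atTop 0, hexp.eventually_lt_const one_pos] with α hα hr
      refine limsup_le_of_le (isBoundedUnder_of_eventually_ge (hge0 α)).isCoboundedUnder_le ?_
      filter_upwards [eventually_gt_atTop 0] with n hn
      exact dmax_le_of_nonneg hp0 hp1 hα hn hr
end

section
/- There exists a Markovian coupling ((σ_t, σ̃_t)) of two copies of the cyclic dynamics with p = 1/2 (the semi-synchronized coupling), started from arbitrary σ_0, σ̃_0 ∈ Σ_n, such that the corresponding proportion chains satisfy E^{SC}_{σ_0,σ̃_0} ‖S_t − S̃_t‖_1 ≤ (1 − 1/(2n))^t ‖S_0 − S̃_0‖_1 for every t ≥ 0. -/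
open Finset

/-- Proportion vector `S(σ) ∈ ℝ³`. -/
noncomputable def propVec {n : ℕ} (σ : Config n) : Fin 3 → ℝ :=
  fun k => ((univ.filter fun v => σ v = k).card : ℝ) / n

/-- ℓ¹ norm on `ℝ³`. -/
def l1 (x : Fin 3 → ℝ) : ℝ := ∑ k, |x k|

/-- A Markovian coupling of two copies of the cyclic dynamics: a transition matrix on
`Σ_n × Σ_n` with nonnegative entries whose marginal transitions are both `cyclicP n p`. -/
def IsCoupling (n : ℕ) (p : ℝ) (K : Matrix (Config n × Config n) (Config n × Config n) ℝ) : Prop :=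
  (∀ x y, 0 ≤ K x y) ∧
  (∀ x : Config n × Config n, ∀ τ : Config n,
      ∑ τ' : Config n, K x (τ, τ') = cyclicP n p x.1 τ) ∧
  (∀ x : Config n × Config n, ∀ τ' : Config n,
      ∑ τ : Config n, K x (τ, τ') = cyclicP n p x.2 τ')

lemma sum_pow_mul_le_pow_mul {ι : Type*} [Fintype ι] [DecidableEq ι] {K : Matrix ι ι ℝ}
    (hK : ∀ x y, 0 ≤ K x y) {f : ι → ℝ} {c : ℝ} (hc : 0 ≤ c)
    (h : ∀ x, ∑ y, K x y * f y ≤ c * f x) (t : ℕ) (x : ι) :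
    ∑ y, (K ^ t) x y * f y ≤ c ^ t * f x := by
  induction t generalizing x with
  | zero => simp [Matrix.one_apply]
  | succ t ih =>
    calc ∑ y, (K ^ (t + 1)) x y * f y = ∑ z, K x z * ∑ y, (K ^ t) z y * f y := by
          simp only [pow_succ', Matrix.mul_apply, Finset.sum_mul, Finset.mul_sum, mul_assoc]
          exact Finset.sum_comm
      _ ≤ ∑ z, K x z * (c ^ t * f z) :=
          Finset.sum_le_sum fun z _ => mul_le_mul_of_nonneg_left (ih z) (hK x z)
      _ = c ^ t * ∑ z, K x z * f z := by
          rw [Finset.mul_sum]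
          exact Finset.sum_congr rfl fun z _ => by ring
      _ ≤ c ^ t * (c * f x) := mul_le_mul_of_nonneg_left (h x) (pow_nonneg hc t)
      _ = c ^ (t + 1) * f x := by ring

/-- Number of vertices of color `k` in `σ`. -/
def colorCount {n : ℕ} (σ : Config n) (k : Fin 3) : ℤ :=
  ∑ v, if σ v = k then 1 else 0

/-- The configuration `σ` with the color of `v` advanced cyclically by one. -/
def rotateAt {n : ℕ} (σ : Config n) (v : Fin n) : Config n :=
  Function.update σ v (σ v + 1)

/-- The `ℓ¹` distance between the color counts of two configurations. -/
def countDist {n : ℕ} (σ σ' : Config n) : ℤ :=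
  ∑ k, |colorCount σ k - colorCount σ' k|

lemma l1_propVec_sub {n : ℕ} (σ σ' : Config n) :
    l1 (propVec σ - propVec σ') = (countDist σ σ' : ℝ) / n := by
  simp only [l1, propVec, countDist, colorCount, Pi.sub_apply, Finset.card_filter]
  push_cast
  rw [Finset.sum_div]
  refine Finset.sum_congr rfl fun k _ => ?_
  rw [← sub_div, abs_div, Nat.abs_cast]

lemma colorCount_rotateAt {n : ℕ} (σ : Config n) (v : Fin n) (k : Fin 3) :
    colorCount (rotateAt σ v) k =
      colorCount σ k - (if σ v = k then 1 else 0) + (if σ v + 1 = k then 1 else 0) := by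
  unfold colorCount rotateAt
  rw [← Finset.add_sum_erase _ _ (Finset.mem_univ v),
    ← Finset.add_sum_erase univ (fun w => if σ w = k then (1 : ℤ) else 0) (Finset.mem_univ v),
    Finset.sum_congr rfl (g := fun w => if σ w = k then (1 : ℤ) else 0)]
  · simp only [Function.update_self]
    ring
  · intro w hw
    rw [Function.update_of_ne (Finset.ne_of_mem_erase hw)]

/-- Moving one unit out of a color in excess, or one unit of the other configuration out of a
color in deficit, decreases the `ℓ¹` norm by one on average. -/
lemma sum_abs_excess_deficit_le (d : Fin 3 → ℤ) {i j : Fin 3} (hi : 0 < d i) (hj : d j < 0) :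
    (∑ k, |d k - (if i = k then 1 else 0) + (if i + 1 = k then 1 else 0)|)
      + ∑ k, |d k + (if j = k then 1 else 0) - (if j + 1 = k then 1 else 0)|
      ≤ 2 * (∑ k, |d k|) - 2 := by
  simp only [Fin.sum_univ_three]
  fin_cases i <;> fin_cases j <;> simp [Fin.ext_iff] at hi hj ⊢ <;> grind

/-- The pairing `φ` is optimal: a color of the first configuration at an unmatched pair never
occurs as a color of the second configuration at an unmatched pair. -/
def IsOptimalPairing {n : ℕ} (σ σ' : Config n) (φ : Equiv.Perm (Fin n)) : Prop :=
  ∀ v w, σ v ≠ σ' (φ v) → σ w ≠ σ' (φ w) → σ v ≠ σ' (φ w)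

lemma exists_isOptimalPairing {n : ℕ} (σ σ' : Config n) :
    ∃ φ : Equiv.Perm (Fin n), IsOptimalPairing σ σ' φ := by
  obtain ⟨φ, -, hφ⟩ := Finset.exists_max_image (univ : Finset (Equiv.Perm (Fin n)))
    (fun φ => (univ.filter fun v => σ v = σ' (φ v)).card) ⟨1, Finset.mem_univ _⟩
  refine ⟨φ, fun v w hv hw hvw => ?_⟩
  have hne : v ≠ w := by
    rintro rfl
    exact hv hvw
  refine (hφ (φ * Equiv.swap v w) (Finset.mem_univ _)).not_gt (Finset.card_lt_card ?_)
  refine Finset.ssubset_iff_of_subset (fun u hu => ?_) |>.2 ⟨v, ?_, ?_⟩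
  · simp only [Finset.mem_filter, Finset.mem_univ, true_and] at hu ⊢
    have huv : u ≠ v := by
      rintro rfl
      exact hv hu
    have huw : u ≠ w := by
      rintro rfl
      exact hw hu
    simpa [Equiv.swap_apply_of_ne_of_ne huv huw] using hu
  · simp only [Finset.mem_filter, Finset.mem_univ, true_and]
    simpa using hvw
  · simpa using hv

lemma colorCount_comp_perm {n : ℕ} (σ : Config n) (φ : Equiv.Perm (Fin n)) (k : Fin 3) :
    colorCount σ k = ∑ v, if σ (φ v) = k then 1 else 0 :=
  (Equiv.sum_comp φ fun v => if σ v = k then (1 : ℤ) else 0).symm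

lemma colorCount_sub_eq {n : ℕ} (σ σ' : Config n) (φ : Equiv.Perm (Fin n)) (k : Fin 3) :
    colorCount σ k - colorCount σ' k =
      ∑ v, ((if σ v = k then 1 else 0) - (if σ' (φ v) = k then 1 else 0)) := by
  rw [colorCount_comp_perm σ' φ, Finset.sum_sub_distrib, colorCount]

lemma IsOptimalPairing.excess {n : ℕ} {σ σ' : Config n} {φ : Equiv.Perm (Fin n)}
    (h : IsOptimalPairing σ σ' φ) {v : Fin n} (hv : σ v ≠ σ' (φ v)) :
    0 < colorCount σ (σ v) - colorCount σ' (σ v) := by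
  rw [colorCount_sub_eq σ σ' φ]
  refine Finset.sum_pos' (fun w _ => ?_) ⟨v, Finset.mem_univ _, ?_⟩
  · have := h v w hv
    grind
  · simp [hv.symm]

lemma IsOptimalPairing.deficit {n : ℕ} {σ σ' : Config n} {φ : Equiv.Perm (Fin n)}
    (h : IsOptimalPairing σ σ' φ) {v : Fin n} (hv : σ v ≠ σ' (φ v)) :
    colorCount σ (σ' (φ v)) - colorCount σ' (σ' (φ v)) < 0 := by
  rw [colorCount_sub_eq σ σ' φ, ← neg_pos, ← Finset.sum_neg_distrib]
  refine Finset.sum_pos' (fun w _ => ?_) ⟨v, Finset.mem_univ _, ?_⟩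
  · have := fun hw => h w v hw hv
    grind
  · simp [hv]

lemma countDist_le_two_mul_mismatches {n : ℕ} (σ σ' : Config n) (φ : Equiv.Perm (Fin n)) :
    countDist σ σ' ≤ 2 * ∑ v, if σ v = σ' (φ v) then 0 else 1 := by
  simp only [countDist, colorCount_sub_eq σ σ' φ]
  refine (Finset.sum_le_sum fun k _ => Finset.abs_sum_le_sum_abs _ _).trans ?_
  rw [Finset.sum_comm, Finset.mul_sum]
  refine Finset.sum_le_sum fun v _ => ?_
  generalize σ v = i
  generalize σ' (φ v) = j
  revert i j
  decide

lemma countDist_rotateAt_both {n : ℕ} (σ σ' : Config n) {v w : Fin n} (h : σ v = σ' w) :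
    countDist (rotateAt σ v) (rotateAt σ' w) = countDist σ σ' := by
  unfold countDist
  refine Finset.sum_congr rfl fun k _ => ?_
  rw [colorCount_rotateAt, colorCount_rotateAt, h]
  congr 1
  ring

lemma IsOptimalPairing.countDist_rotateAt_add_le {n : ℕ} {σ σ' : Config n}
    {φ : Equiv.Perm (Fin n)} (h : IsOptimalPairing σ σ' φ) {v : Fin n} (hv : σ v ≠ σ' (φ v)) :
    countDist (rotateAt σ v) σ' + countDist σ (rotateAt σ' (φ v)) ≤ 2 * countDist σ σ' - 2 := by
  refine le_of_eq_of_le ?_ (sum_abs_excess_deficit_le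
    (fun k => colorCount σ k - colorCount σ' k) (h.excess hv) (h.deficit hv))
  unfold countDist
  congr 1 <;> refine Finset.sum_congr rfl fun k _ => ?_ <;>
    rw [colorCount_rotateAt] <;> congr 1 <;> ring

/-- A pairing of the vertices of two configurations which is optimal. -/
noncomputable def optimalPairing {n : ℕ} (σ σ' : Config n) : Equiv.Perm (Fin n) :=
  (exists_isOptimalPairing σ σ').choose

lemma isOptimalPairing_optimalPairing {n : ℕ} (σ σ' : Config n) :
    IsOptimalPairing σ σ' (optimalPairing σ σ') :=
  (exists_isOptimalPairing σ σ').choose_spec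

/-- One step of the coupling at a paired couple of vertices `v`, `w`: vertices of equal color
move together, and otherwise exactly one of the two moves. -/
noncomputable def pairStep {n : ℕ} (σ σ' : Config n) (v w : Fin n) (y : Config n × Config n) : ℝ :=
  if σ v = σ' w then
    1 / 2 * (if y = (σ, σ') then 1 else 0)
      + 1 / 2 * (if y = (rotateAt σ v, rotateAt σ' w) then 1 else 0)
  else
    1 / 2 * (if y = (rotateAt σ v, σ') then 1 else 0)
      + 1 / 2 * (if y = (σ, rotateAt σ' w) then 1 else 0)

/-- Transition matrix of the semi-synchronized coupling. -/
noncomputable def semiSyncCoupling (n : ℕ) :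
    Matrix (Config n × Config n) (Config n × Config n) ℝ :=
  Matrix.of fun x y =>
    1 / (n : ℝ) * ∑ v, pairStep x.1 x.2 v (optimalPairing x.1 x.2 v) y

lemma sum_pairStep_snd {n : ℕ} (σ σ' τ : Config n) (v w : Fin n) :
    ∑ τ', pairStep σ σ' v w (τ, τ') =
      (1 - 1 / 2) * (if τ = σ then 1 else 0) + 1 / 2 * (if τ = rotateAt σ v then 1 else 0) := by
  unfold pairStep
  by_cases h : σ v = σ' w <;> simp [h, Finset.sum_add_distrib, ite_and] <;> split_ifs <;> norm_num

lemma sum_pairStep_fst {n : ℕ} (σ σ' τ' : Config n) (v w : Fin n) :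
    ∑ τ, pairStep σ σ' v w (τ, τ') =
      (1 - 1 / 2) * (if τ' = σ' then 1 else 0)
        + 1 / 2 * (if τ' = rotateAt σ' w then 1 else 0) := by
  unfold pairStep
  by_cases h : σ v = σ' w <;> simp [h, Finset.sum_add_distrib, ite_and] <;> split_ifs <;> norm_num

lemma isCoupling_semiSyncCoupling (n : ℕ) : IsCoupling n (1 / 2) (semiSyncCoupling n) := by
  refine ⟨fun x y => ?_, fun x τ => ?_, fun x τ' => ?_⟩
  · refine mul_nonneg (by positivity) (Finset.sum_nonneg fun v _ => ?_)
    unfold pairStep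
    split_ifs <;> norm_num
  · simp only [semiSyncCoupling, cyclicP, Matrix.of_apply]
    rw [← Finset.mul_sum, Finset.sum_comm]
    simp only [sum_pairStep_snd]
    rfl
  · simp only [semiSyncCoupling, cyclicP, Matrix.of_apply]
    rw [← Finset.mul_sum, Finset.sum_comm]
    simp only [sum_pairStep_fst]
    rw [Equiv.sum_comp (optimalPairing x.1 x.2) fun w =>
      (1 - 1 / 2 : ℝ) * (if τ' = x.2 then 1 else 0)
        + 1 / 2 * (if τ' = rotateAt x.2 w then 1 else 0)]
    rfl

lemma sum_pairStep_mul {n : ℕ} (σ σ' : Config n) (v w : Fin n) (f : Config n × Config n → ℝ) :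
    ∑ y, pairStep σ σ' v w y * f y =
      if σ v = σ' w then 1 / 2 * f (σ, σ') + 1 / 2 * f (rotateAt σ v, rotateAt σ' w)
      else 1 / 2 * f (rotateAt σ v, σ') + 1 / 2 * f (σ, rotateAt σ' w) := by
  unfold pairStep
  split_ifs <;> simp [add_mul, Finset.sum_add_distrib]

lemma sum_pairStep_countDist_le {n : ℕ} {σ σ' : Config n} {φ : Equiv.Perm (Fin n)}
    (h : IsOptimalPairing σ σ' φ) (v : Fin n) :
    ∑ y, pairStep σ σ' v (φ v) y * (countDist y.1 y.2 : ℝ)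
      ≤ countDist σ σ' - (if σ v = σ' (φ v) then 0 else 1) := by
  rw [sum_pairStep_mul σ σ' v (φ v) fun y => (countDist y.1 y.2 : ℝ)]
  split_ifs with hv
  · rw [countDist_rotateAt_both σ σ' hv]
    linarith
  · have : (countDist (rotateAt σ v) σ' : ℝ) + countDist σ (rotateAt σ' (φ v))
        ≤ 2 * countDist σ σ' - 2 := by
      exact_mod_cast h.countDist_rotateAt_add_le hv
    linarith

lemma sum_semiSyncCoupling_countDist_le {n : ℕ} (hn : 1 ≤ n) (x : Config n × Config n) :
    ∑ y, semiSyncCoupling n x y * (countDist y.1 y.2 : ℝ)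
      ≤ (1 - 1 / (2 * n)) * countDist x.1 x.2 := by
  have hn' : (0 : ℝ) < n := by exact_mod_cast hn
  set φ := optimalPairing x.1 x.2
  have hM : (countDist x.1 x.2 : ℝ) ≤ 2 * ∑ v, if x.1 v = x.2 (φ v) then (0 : ℝ) else 1 := by
    have := countDist_le_two_mul_mismatches x.1 x.2 φ
    exact_mod_cast this
  calc ∑ y, semiSyncCoupling n x y * (countDist y.1 y.2 : ℝ)
      = 1 / (n : ℝ) * ∑ v, ∑ y, pairStep x.1 x.2 v (φ v) y * (countDist y.1 y.2 : ℝ) := by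
        rw [Finset.sum_comm, Finset.mul_sum]
        refine Finset.sum_congr rfl fun y _ => ?_
        rw [semiSyncCoupling, Matrix.of_apply, mul_assoc, Finset.sum_mul]
    _ ≤ 1 / (n : ℝ) * ∑ v, ((countDist x.1 x.2 : ℝ) - if x.1 v = x.2 (φ v) then 0 else 1) := by
        gcongr with v
        exact sum_pairStep_countDist_le (isOptimalPairing_optimalPairing x.1 x.2) v
    _ = 1 / (n : ℝ) * (n * countDist x.1 x.2 - ∑ v, if x.1 v = x.2 (φ v) then (0 : ℝ) else 1) := by
        rw [Finset.sum_sub_distrib]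
        simp
    _ ≤ 1 / (n : ℝ) * (n * countDist x.1 x.2 - countDist x.1 x.2 / 2) := by
        gcongr
        linarith
    _ = (1 - 1 / (2 * n)) * countDist x.1 x.2 := by
        field_simp

/-- there is a Markovian coupling (the semi-synchronized coupling) of two
copies of the cyclic dynamics with `p = 1/2` under which the proportion chains satisfy
`E‖S_t − S̃_t‖₁ ≤ (1 − 1/(2n))^t ‖S_0 − S̃_0‖₁` for all starting points and all `t`. -/
theorem semi_synchronized_coupling_contraction (n : ℕ) (hn : 1 ≤ n) :
    ∃ K : Matrix (Config n × Config n) (Config n × Config n) ℝ,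
      IsCoupling n (1/2) K ∧
      ∀ (σ0 σ0' : Config n) (t : ℕ),
        ∑ y : Config n × Config n,
            (K ^ t) (σ0, σ0') y * l1 (propVec y.1 - propVec y.2)
          ≤ (1 - 1 / (2 * n)) ^ t * l1 (propVec σ0 - propVec σ0') := by
  have hn' : (1 : ℝ) ≤ n := by exact_mod_cast hn
  refine ⟨semiSyncCoupling n, isCoupling_semiSyncCoupling n, fun σ0 σ0' t => ?_⟩
  refine sum_pow_mul_le_pow_mul (isCoupling_semiSyncCoupling n).1
    (f := fun y => l1 (propVec y.1 - propVec y.2)) ?_ (fun x => ?_) t (σ0, σ0')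
  · rw [sub_nonneg, div_le_one (by positivity)]
    linarith
  · simp only [l1_propVec_sub, ← mul_div_assoc]
    rw [← Finset.sum_div]
    gcongr
    exact sum_semiSyncCoupling_countDist_le hn x
end

section
/- Let (Z_t) be a Markov chain taking values in ℝ^d (with some transition kernel), with E_z and Var_z denoting expectation and variance when Z_0 = z, and suppose v_1 = sup_{z_0} E_{z_0}‖Z_1 − E_{z_0}Z_1‖_2² is finite. If there exist 0 < ρ < 1 and c > 1 such that ‖E_z[Z_t] − E_{z̃}[Z_t]‖_2 ≤ c ρ^t ‖z − z̃‖_2 for every pair of starting points (z, z̃) and every t ≥ 0, then v_t := sup_{z_0} E_{z_0}‖Z_t − E_{z_0}Z_t‖_2² satisfies v_t ≤ c² v_1 min{t, (1 − ρ²)^{−1}} for every t ≥ 1. -/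
open MeasureTheory ProbabilityTheory

/-- `t`-step kernel of a time-homogeneous Markov chain with one-step kernel `κ`. -/
noncomputable def iterK {X : Type*} [MeasurableSpace X] (κ : Kernel X X) : ℕ → Kernel X X
  | 0 => Kernel.id
  | (t + 1) => κ ∘ₖ iterK κ t

/-- `E_z[Z_t]`, the mean at time `t` of the chain started at `z`. -/
noncomputable def chainMean {d : ℕ}
    (κ : Kernel (EuclideanSpace ℝ (Fin d)) (EuclideanSpace ℝ (Fin d)))
    (t : ℕ) (z : EuclideanSpace ℝ (Fin d)) : EuclideanSpace ℝ (Fin d) :=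
  ∫ x, x ∂(iterK κ t z)

/-- `E_z‖Z_t − E_z Z_t‖₂²`, the variance at time `t` of the chain started at `z`. -/
noncomputable def chainVar {d : ℕ}
    (κ : Kernel (EuclideanSpace ℝ (Fin d)) (EuclideanSpace ℝ (Fin d)))
    (t : ℕ) (z : EuclideanSpace ℝ (Fin d)) : ℝ :=
  ∫ x, ‖x - chainMean κ t z‖ ^ 2 ∂(iterK κ t z)

section Moments

variable {Ω E F : Type*} [MeasurableSpace Ω] [NormedAddCommGroup E] [NormedAddCommGroup F]
  {μ : Measure Ω} [IsProbabilityMeasure μ]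

/-- Bias–variance decomposition of the mean squared distance to a point. -/
theorem integral_norm_sub_sq_eq_add [InnerProductSpace ℝ E] [CompleteSpace E]
    {f : Ω → E} (hf : MemLp f 2 μ) (a : E) :
    ∫ x, ‖f x - a‖ ^ 2 ∂μ
      = ∫ x, ‖f x - ∫ y, f y ∂μ‖ ^ 2 ∂μ + ‖(∫ y, f y ∂μ) - a‖ ^ 2 := by
  set m := ∫ y, f y ∂μ with hm
  have hfint : Integrable f μ := hf.integrable (by norm_num)
  have hsub : Integrable (fun x => f x - m) μ := hfint.sub (integrable_const m)
  have hsq : Integrable (fun x => ‖f x - m‖ ^ 2) μ :=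
    (hf.sub (memLp_const m)).integrable_norm_pow (by norm_num)
  have hinner : Integrable (fun x => 2 * inner ℝ (m - a) (f x - m)) μ :=
    (hsub.const_inner (m - a)).const_mul 2
  have hzero : ∫ x, (f x - m) ∂μ = 0 := by
    rw [integral_sub hfint (integrable_const m)]
    simp [hm]
  calc ∫ x, ‖f x - a‖ ^ 2 ∂μ
      = ∫ x, (‖f x - m‖ ^ 2 + 2 * inner ℝ (m - a) (f x - m) + ‖m - a‖ ^ 2) ∂μ := by
        refine integral_congr_ae (ae_of_all _ fun x => ?_)
        have hx : f x - a = (f x - m) + (m - a) := by abel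
        simp only [hx, norm_add_sq_real, real_inner_comm]
    _ = ∫ x, ‖f x - m‖ ^ 2 ∂μ + ‖m - a‖ ^ 2 := by
        have hadd : Integrable
            (fun x => ‖f x - m‖ ^ 2 + 2 * inner ℝ (m - a) (f x - m)) μ := hsq.add hinner
        rw [integral_add hadd (integrable_const _), integral_add hsq hinner,
          integral_const_mul, integral_inner hsub, hzero]
        simp

/-- Applying a `K`-Lipschitz map multiplies the variance by at most `K ^ 2`. -/
theorem LipschitzWith.integral_norm_sub_integral_sq_le [NormedSpace ℝ E]
    [InnerProductSpace ℝ F] [CompleteSpace F] {K : NNReal} {f : E → F} {X : Ω → E}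
    (hf : LipschitzWith K f) (hX : MemLp X 2 μ) (hfX : MemLp (fun x => f (X x)) 2 μ) :
    ∫ x, ‖f (X x) - ∫ y, f (X y) ∂μ‖ ^ 2 ∂μ
      ≤ (K : ℝ) ^ 2 * ∫ x, ‖X x - ∫ y, X y ∂μ‖ ^ 2 ∂μ := by
  set m := ∫ y, X y ∂μ
  calc ∫ x, ‖f (X x) - ∫ y, f (X y) ∂μ‖ ^ 2 ∂μ
      ≤ ∫ x, ‖f (X x) - f m‖ ^ 2 ∂μ := by
        rw [integral_norm_sub_sq_eq_add hfX (f m)]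
        exact le_add_of_nonneg_right (by positivity)
    _ ≤ ∫ x, (K : ℝ) ^ 2 * ‖X x - m‖ ^ 2 ∂μ := by
        refine integral_mono ((hfX.sub (memLp_const (f m))).integrable_norm_pow (by norm_num))
          (((hX.sub (memLp_const m)).integrable_norm_pow (by norm_num)).const_mul _) fun x => ?_
        rw [← mul_pow]
        exact pow_le_pow_left₀ (norm_nonneg _) (hf.norm_sub_le _ _) 2
    _ = (K : ℝ) ^ 2 * ∫ x, ‖X x - m‖ ^ 2 ∂μ := integral_const_mul _ _

/-- A Lipschitz function of a square-integrable variable is square-integrable under a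
probability measure. -/
theorem LipschitzWith.memLp_two_comp {K : NNReal} {f : E → F} {X : Ω → E} (hf : LipschitzWith K f) (hX : MemLp X 2 μ) :
    MemLp (fun x => f (X x)) 2 μ := by
  have hlip : LipschitzWith K fun x => f x - f 0 :=
    LipschitzWith.of_dist_le_mul fun x y => by simpa using hf.dist_le_mul x y
  have h := (hlip.comp_memLp (by simp) hX).add (memLp_const (μ := μ) (f 0))
  refine h.ae_eq (ae_of_all _ fun x => ?_)
  simp

end Moments

section IterK

variable {X : Type*} [MeasurableSpace X] (κ : Kernel X X)

instance isMarkovKernel_iterK [IsMarkovKernel κ] (t : ℕ) : IsMarkovKernel (iterK κ t) := by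
  induction t with
  | zero => rw [iterK]; infer_instance
  | succ t ih => rw [iterK]; infer_instance

theorem iterK_one : iterK κ 1 = κ := by simp [iterK]

theorem iterK_succ_eq_comp (t : ℕ) : iterK κ (t + 1) = iterK κ t ∘ₖ κ := by
  induction t with
  | zero => simp [iterK]
  | succ t ih => rw [iterK, ih, ← Kernel.comp_assoc, ← iterK, ih]

end IterK

section Chain

variable {d : ℕ} {κ : Kernel (EuclideanSpace ℝ (Fin d)) (EuclideanSpace ℝ (Fin d))}

theorem chainMean_zero (z : EuclideanSpace ℝ (Fin d)) : chainMean κ 0 z = z := by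
  simp [chainMean, iterK, Kernel.id_apply]

theorem chainMean_succ {t : ℕ} {z : EuclideanSpace ℝ (Fin d)}
    (h : Integrable (fun x => x) (iterK κ (t + 1) z)) :
    chainMean κ (t + 1) z = ∫ x, chainMean κ t x ∂(κ z) := by
  rw [iterK_succ_eq_comp] at h
  rw [chainMean, iterK_succ_eq_comp, Kernel.integral_comp h]
  rfl

theorem memLp_two_iterK [IsMarkovKernel κ] {t : ℕ} {z : EuclideanSpace ℝ (Fin d)}
    (h : Integrable (fun x => ‖x - chainMean κ t z‖ ^ 2) (iterK κ t z)) :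
    MemLp (fun x => x) 2 (iterK κ t z) := by
  have hsub : MemLp (fun x => x - chainMean κ t z) 2 (iterK κ t z) :=
    (memLp_two_iff_integrable_sq_norm (by fun_prop)).2 h
  refine (hsub.add (memLp_const (chainMean κ t z))).ae_eq (ae_of_all _ fun x => ?_)
  simp

/-- The variance of the predicted mean `E_{Z_s}[Z_k]` is at most the sum over the first `s` steps
of the one-step variances, each damped by the remaining contraction. -/
theorem integral_norm_chainMean_sub_sq_le [IsMarkovKernel κ]
    (hint : ∀ (t : ℕ) (z : EuclideanSpace ℝ (Fin d)), Integrable (fun x => x) (iterK κ t z))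
    (hint2 : ∀ (t : ℕ) (z : EuclideanSpace ℝ (Fin d)),
      Integrable (fun x => ‖x - chainMean κ t z‖ ^ 2) (iterK κ t z))
    {K : ℕ → NNReal} (hK : ∀ t, LipschitzWith (K t) (chainMean κ t))
    {v : ℝ} (hv : ∀ z, chainVar κ 1 z ≤ v) (s k : ℕ) (z : EuclideanSpace ℝ (Fin d)) :
    ∫ x, ‖chainMean κ k x - chainMean κ (k + s) z‖ ^ 2 ∂(iterK κ s z)
      ≤ (∑ i ∈ Finset.range s, (K (k + i) : ℝ) ^ 2) * v := by
  have hL2 (j t : ℕ) (y : EuclideanSpace ℝ (Fin d)) :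
      MemLp (fun x => chainMean κ j x) 2 (iterK κ t y) :=
    (hK j).memLp_two_comp (memLp_two_iterK (hint2 t y))
  have hsq (j t : ℕ) (y a : EuclideanSpace ℝ (Fin d)) :
      Integrable (fun x => ‖chainMean κ j x - a‖ ^ 2) (iterK κ t y) :=
    ((hL2 j t y).sub (memLp_const a)).integrable_norm_pow (by norm_num)
  induction s generalizing k with
  | zero =>
    rw [iterK, Kernel.id_apply, integral_dirac]
    simp
  | succ s ih =>
    set a := chainMean κ (k + (s + 1)) z with ha
    have hstep (x : EuclideanSpace ℝ (Fin d)) :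
        ∫ y, ‖chainMean κ k y - a‖ ^ 2 ∂(κ x)
          ≤ ‖chainMean κ (k + 1) x - a‖ ^ 2 + (K k : ℝ) ^ 2 * v := by
      have hκ := hL2 k 1 x
      have hid := memLp_two_iterK (hint2 1 x)
      have hvx := hv x
      rw [chainVar, chainMean] at hvx
      rw [iterK_one] at hκ hid hvx
      have hvar := (hK k).integral_norm_sub_integral_sq_le hid hκ
      rw [integral_norm_sub_sq_eq_add hκ a, chainMean_succ (hint (k + 1) x)]
      have := mul_le_mul_of_nonneg_left hvx (sq_nonneg (K k : ℝ))
      linarith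
    have hcomp : Integrable (fun x => ‖chainMean κ k x - a‖ ^ 2) ((κ ∘ₖ iterK κ s) z) :=
      hsq k (s + 1) z a
    have hprev := ih (k + 1)
    rw [show k + 1 + s = k + (s + 1) by omega, ← ha] at hprev
    calc ∫ x, ‖chainMean κ k x - a‖ ^ 2 ∂(iterK κ (s + 1) z)
        = ∫ x, ∫ y, ‖chainMean κ k y - a‖ ^ 2 ∂(κ x) ∂(iterK κ s z) := by
          rw [iterK, Kernel.integral_comp hcomp]
      _ ≤ ∫ x, (‖chainMean κ (k + 1) x - a‖ ^ 2 + (K k : ℝ) ^ 2 * v) ∂(iterK κ s z) :=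
          integral_mono hcomp.integral_comp
            ((hsq (k + 1) s z a).add (integrable_const _)) hstep
      _ = ∫ x, ‖chainMean κ (k + 1) x - a‖ ^ 2 ∂(iterK κ s z) + (K k : ℝ) ^ 2 * v := by
          rw [integral_add (hsq (k + 1) s z a) (integrable_const _)]
          simp
      _ ≤ (∑ i ∈ Finset.range (s + 1), (K (k + i) : ℝ) ^ 2) * v := by
          have hshift : ∑ i ∈ Finset.range s, (K (k + (i + 1)) : ℝ) ^ 2
              = ∑ i ∈ Finset.range s, (K (k + 1 + i) : ℝ) ^ 2 :=
            Finset.sum_congr rfl fun i _ => by rw [add_assoc k 1 i, add_comm 1 i]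
          rw [Finset.sum_range_succ', add_mul, hshift, add_zero]
          linarith

end Chain

theorem geom_sum_le_min {r : ℝ} (hr0 : 0 ≤ r) (hr1 : r < 1) (t : ℕ) :
    ∑ i ∈ Finset.range t, r ^ i ≤ min (t : ℝ) (1 - r)⁻¹ := by
  refine le_min ?_ ?_
  · calc ∑ i ∈ Finset.range t, r ^ i ≤ ∑ _i ∈ Finset.range t, (1 : ℝ) :=
          Finset.sum_le_sum fun i _ => pow_le_one₀ hr0 hr1.le
      _ = t := by simp
  · rw [← tsum_geometric_of_lt_one hr0 hr1]
    exact (summable_geometric_of_lt_one hr0 hr1).sum_le_tsum _ fun i _ => pow_nonneg hr0 i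

/-- if the means of the chain contract with rate `cρ^t` and
`v₁ = sup_z Var_z(Z₁)` is finite, then
`v_t ≤ c² v₁ min{t, (1 − ρ²)⁻¹}` for all `t ≥ 1`. -/
theorem variance_bound_from_mean_contraction {d : ℕ}
    (κ : Kernel (EuclideanSpace ℝ (Fin d)) (EuclideanSpace ℝ (Fin d))) [IsMarkovKernel κ]
    (hint : ∀ (t : ℕ) (z : EuclideanSpace ℝ (Fin d)),
      Integrable (fun x => x) (iterK κ t z))
    (hint2 : ∀ (t : ℕ) (z : EuclideanSpace ℝ (Fin d)),
      Integrable (fun x => ‖x - chainMean κ t z‖ ^ 2) (iterK κ t z))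
    (hbdd : BddAbove (Set.range (chainVar κ 1)))
    (ρ c : ℝ) (hρ0 : 0 < ρ) (hρ1 : ρ < 1) (hc : 1 < c)
    (hcontr : ∀ (z z' : EuclideanSpace ℝ (Fin d)) (t : ℕ),
      ‖chainMean κ t z - chainMean κ t z'‖ ≤ c * ρ ^ t * ‖z - z'‖) :
    ∀ t : ℕ, 1 ≤ t → ∀ z0 : EuclideanSpace ℝ (Fin d),
      chainVar κ t z0 ≤ c ^ 2 * (⨆ z, chainVar κ 1 z) * min (t : ℝ) (1 - ρ ^ 2)⁻¹ := by
  intro t _ z0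
  have hv (z : EuclideanSpace ℝ (Fin d)) : chainVar κ 1 z ≤ ⨆ z, chainVar κ 1 z :=
    le_ciSup hbdd z
  have hv0 : 0 ≤ ⨆ z, chainVar κ 1 z :=
    Real.iSup_nonneg fun z => integral_nonneg fun x => by positivity
  have hKnonneg (j : ℕ) : 0 ≤ c * ρ ^ j := by positivity
  have hK (j : ℕ) : LipschitzWith (⟨c * ρ ^ j, hKnonneg j⟩ : NNReal) (chainMean κ j) :=
    LipschitzWith.of_dist_le_mul fun x y => by
      rw [dist_eq_norm, dist_eq_norm]
      exact hcontr x y j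
  have hmain := integral_norm_chainMean_sub_sq_le hint hint2 hK hv t 0 z0
  simp only [chainMean_zero, zero_add] at hmain
  calc chainVar κ t z0
      ≤ (∑ i ∈ Finset.range t, (c * ρ ^ i) ^ 2) * ⨆ z, chainVar κ 1 z := hmain
    _ = c ^ 2 * (⨆ z, chainVar κ 1 z) * ∑ i ∈ Finset.range t, (ρ ^ 2) ^ i := by
        simp only [mul_pow, ← Finset.mul_sum, ← pow_mul, mul_comm 2]
        ring
    _ ≤ c ^ 2 * (⨆ z, chainVar κ 1 z) * min (t : ℝ) (1 - ρ ^ 2)⁻¹ :=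
        mul_le_mul_of_nonneg_left
          (geom_sum_le_min (sq_nonneg ρ) (pow_lt_one₀ hρ0.le hρ1 two_ne_zero) t) (by positivity)
end

section
/- For the cyclic dynamics with p = 1/2, the variance of the proportion chain is O(1/n) uniformly: there exists a constant C > 0, independent of n, σ_0 and t, such that for all n ≥ 1, all σ_0 ∈ Σ_n and all t ≥ 0, E_{σ_0}‖S_t − E_{σ_0}S_t‖_2² ≤ C/n. -/
open Finset

/-- Expectation of `f(σ_t)` for the chain started at `σ0`. -/
noncomputable def Ex (n : ℕ) (p : ℝ) (σ0 : Config n) (t : ℕ) (f : Config n → ℝ) : ℝ :=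
  ∑ τ : Config n, lawAt n p σ0 t τ * f τ

/-- Squared Euclidean norm on `ℝ³`. -/
def l2sq (x : Fin 3 → ℝ) : ℝ := ∑ k, (x k) ^ 2

/-- Image of `f` under one step of the dynamics: `E[f(σ_{t+1}) | σ_t = σ]`. -/
noncomputable def stepMean (n : ℕ) (p : ℝ) (f : Config n → ℝ) (σ : Config n) : ℝ :=
  (1 / (n : ℝ)) * ∑ v : Fin n, ((1 - p) * f σ + p * f (Function.update σ v (σ v + 1)))

theorem sum_cyclicP_mul (n : ℕ) (p : ℝ) (f : Config n → ℝ) (σ : Config n) :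
    ∑ τ, cyclicP n p σ τ * f τ = stepMean n p f σ := by
  simp only [cyclicP, stepMean, Matrix.of_apply, mul_assoc, ← Finset.mul_sum]
  congr 1
  simp only [Finset.sum_mul]
  rw [Finset.sum_comm]
  refine Finset.sum_congr rfl fun v _ => ?_
  simp only [add_mul, mul_assoc, Finset.sum_add_distrib, ← Finset.mul_sum, ite_mul, one_mul,
    zero_mul, Finset.sum_ite_eq', Finset.mem_univ, if_true]

theorem Ex_succ (n : ℕ) (p : ℝ) (σ0 : Config n) (t : ℕ) (f : Config n → ℝ) :
    Ex n p σ0 (t + 1) f = Ex n p σ0 t (stepMean n p f) := by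
  simp only [Ex, lawAt, pow_succ, Matrix.mul_apply, Finset.sum_mul, ← sum_cyclicP_mul,
    Finset.mul_sum]
  rw [Finset.sum_comm]
  simp only [mul_assoc]

theorem Ex_zero (n : ℕ) (p : ℝ) (σ0 : Config n) (f : Config n → ℝ) :
    Ex n p σ0 0 f = f σ0 := by
  simp [Ex, lawAt, Matrix.one_apply]

theorem Ex_add (n : ℕ) (p : ℝ) (σ0 : Config n) (t : ℕ) (f g : Config n → ℝ) :
    Ex n p σ0 t (fun τ => f τ + g τ) = Ex n p σ0 t f + Ex n p σ0 t g := by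
  simp only [Ex, mul_add, Finset.sum_add_distrib]

theorem Ex_const_mul (n : ℕ) (p : ℝ) (σ0 : Config n) (t : ℕ) (c : ℝ) (f : Config n → ℝ) :
    Ex n p σ0 t (fun τ => c * f τ) = c * Ex n p σ0 t f := by
  simp only [Ex, Finset.mul_sum, mul_left_comm]

theorem Ex_const {n : ℕ} (hn : 1 ≤ n) (p : ℝ) (σ0 : Config n) (t : ℕ) (c : ℝ) :
    Ex n p σ0 t (fun _ => c) = c := by
  have hn0 : (n : ℝ) ≠ 0 := by positivity
  induction t with
  | zero => exact Ex_zero n p σ0 _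
  | succ t ih =>
    have hstep : stepMean n p (fun _ => c) = fun _ => c := by
      funext σ
      simp only [stepMean, Finset.sum_const, Finset.card_univ, Fintype.card_fin, nsmul_eq_mul]
      field_simp
      ring
    rw [Ex_succ, hstep, ih]

theorem Ex_nonneg (n : ℕ) {p : ℝ} (hp0 : 0 ≤ p) (hp1 : p ≤ 1) (σ0 : Config n) (t : ℕ)
    {f : Config n → ℝ} (hf : ∀ σ, 0 ≤ f σ) : 0 ≤ Ex n p σ0 t f := by
  induction t generalizing f with
  | zero => rw [Ex_zero]; exact hf σ0
  | succ t ih =>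
    rw [Ex_succ]
    refine ih fun σ => mul_nonneg (by positivity) (Finset.sum_nonneg fun v _ => ?_)
    exact add_nonneg (mul_nonneg (by linarith) (hf _)) (mul_nonneg hp0 (hf _))

theorem sum_indicator_eq_propVec {n : ℕ} (hn : 1 ≤ n) (σ : Config n) (k : Fin 3) :
    ∑ v, (if σ v = k then (1 : ℝ) else 0) = n * propVec σ k := by
  have hn0 : (n : ℝ) ≠ 0 := by positivity
  simp only [propVec, Finset.sum_boole]
  field_simp

theorem propVec_update {n : ℕ} (hn : 1 ≤ n) (σ : Config n) (v : Fin n) (c k : Fin 3) :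
    propVec (Function.update σ v c) k = propVec σ k +
      ((if c = k then (1 : ℝ) else 0) - (if σ v = k then 1 else 0)) / n := by
  have hn0 : (n : ℝ) ≠ 0 := by positivity
  have hσ := sum_indicator_eq_propVec hn σ k
  have hupd := sum_indicator_eq_propVec hn (Function.update σ v c) k
  rw [← Finset.add_sum_erase _ _ (Finset.mem_univ v)] at hσ hupd
  have hrest : ∑ w ∈ Finset.univ.erase v,
      (if Function.update σ v c w = k then (1 : ℝ) else 0) =
      ∑ w ∈ Finset.univ.erase v, (if σ w = k then (1 : ℝ) else 0) :=
    Finset.sum_congr rfl fun w hw => by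
      rw [Function.update_of_ne (Finset.ne_of_mem_erase hw)]
  rw [hrest, Function.update_self] at hupd
  field_simp
  linarith

theorem sum_propVec {n : ℕ} (hn : 1 ≤ n) (σ : Config n) :
    propVec σ 0 + propVec σ 1 + propVec σ 2 = 1 := by
  have hn0 : (n : ℝ) ≠ 0 := by positivity
  have h : ∑ k, ∑ v, (if σ v = k then (1 : ℝ) else 0) = n := by
    rw [Finset.sum_comm]; simp
  simp only [sum_indicator_eq_propVec hn, Fin.sum_univ_three] at h
  refine mul_left_cancel₀ hn0 ?_
  linarith

theorem propVec_add_one {n : ℕ} (σ : Config n) (k : Fin 3) :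
    propVec (fun v => σ v + 1) k = propVec σ (k - 1) := by
  simp only [propVec, eq_sub_iff_add_eq]

theorem stepMean_propVec {n : ℕ} (hn : 1 ≤ n) (k : Fin 3) (σ : Config n) :
    stepMean n (1 / 2) (fun τ => propVec τ k) σ =
      (1 - 1 / (2 * n)) * propVec σ k + 1 / (2 * n) * propVec σ (k - 1) := by
  have hn0 : (n : ℝ) ≠ 0 := by positivity
  simp only [stepMean, propVec_update hn, Finset.sum_add_distrib, ← Finset.mul_sum,
    ← Finset.sum_div, Finset.sum_sub_distrib, sum_indicator_eq_propVec hn,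
    propVec_add_one, Finset.sum_const, Finset.card_univ, Fintype.card_fin,
    nsmul_eq_mul]
  field_simp
  ring

theorem l2sq_propVec_update_add_one {n : ℕ} (hn : 1 ≤ n) (σ : Config n) (v : Fin n) :
    l2sq (propVec (Function.update σ v (σ v + 1))) = l2sq (propVec σ) + 2 / (n : ℝ) ^ 2 +
      2 / n * ∑ k, propVec σ k *
        ((if σ v + 1 = k then (1 : ℝ) else 0) - (if σ v = k then 1 else 0)) := by
  simp only [l2sq, propVec_update hn, Fin.sum_univ_three]
  generalize σ v = c
  fin_cases c <;> simp <;> ring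

theorem stepMean_l2sq_propVec {n : ℕ} (hn : 1 ≤ n) (σ : Config n) :
    stepMean n (1 / 2) (fun τ => l2sq (propVec τ)) σ =
      (1 - 3 / (2 * n)) * l2sq (propVec σ) + (1 / (2 * n) + 1 / (n : ℝ) ^ 2) := by
  have hn0 : (n : ℝ) ≠ 0 := by positivity
  have hsum : propVec σ 2 = 1 - propVec σ 0 - propVec σ 1 := by
    linarith [sum_propVec hn σ]
  have hdrift : ∑ v, ∑ k, propVec σ k *
      ((if σ v + 1 = k then (1 : ℝ) else 0) - (if σ v = k then 1 else 0)) =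
      n * ((1 - 3 * l2sq (propVec σ)) / 2) := by
    rw [Finset.sum_comm]
    simp only [← Finset.mul_sum, Finset.sum_sub_distrib, sum_indicator_eq_propVec hn,
      propVec_add_one, Fin.sum_univ_three, l2sq]
    rw [show (0 : Fin 3) - 1 = 2 from rfl, show (1 : Fin 3) - 1 = 0 from rfl,
      show (2 : Fin 3) - 1 = 1 from rfl, hsum]
    ring
  simp only [stepMean, l2sq_propVec_update_add_one hn, Finset.sum_add_distrib, ← Finset.mul_sum,
    hdrift, Finset.sum_const, Finset.card_univ, Fintype.card_fin, nsmul_eq_mul]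
  field_simp
  ring

/-- Mean of the proportion vector at time `t`. -/
noncomputable def meanProp (n : ℕ) (σ0 : Config n) (t : ℕ) : Fin 3 → ℝ :=
  fun k => Ex n (1 / 2) σ0 t (fun τ => propVec τ k)

theorem sum_meanProp {n : ℕ} (hn : 1 ≤ n) (σ0 : Config n) (t : ℕ) :
    meanProp n σ0 t 0 + meanProp n σ0 t 1 + meanProp n σ0 t 2 = 1 := by
  simp only [meanProp, ← Ex_add, sum_propVec hn, Ex_const hn]

theorem meanProp_succ {n : ℕ} (hn : 1 ≤ n) (σ0 : Config n) (t : ℕ) (k : Fin 3) :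
    meanProp n σ0 (t + 1) k =
      (1 - 1 / (2 * n)) * meanProp n σ0 t k + 1 / (2 * n) * meanProp n σ0 t (k - 1) := by
  simp only [meanProp, Ex_succ, funext (stepMean_propVec hn k), Ex_add, Ex_const_mul]

theorem le_l2sq_meanProp_succ {n : ℕ} (hn : 1 ≤ n) (σ0 : Config n) (t : ℕ) :
    (1 - 3 / (2 * n)) * l2sq (meanProp n σ0 t) + 1 / (2 * n) ≤
      l2sq (meanProp n σ0 (t + 1)) := by
  simp only [l2sq, Fin.sum_univ_three, meanProp_succ hn]
  rw [show (0 : Fin 3) - 1 = 2 from rfl, show (1 : Fin 3) - 1 = 0 from rfl,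
    show (2 : Fin 3) - 1 = 1 from rfl]
  have hsum := sum_meanProp hn σ0 t
  generalize meanProp n σ0 t 0 = a at *
  generalize meanProp n σ0 t 1 = b at *
  generalize meanProp n σ0 t 2 = c at *
  obtain rfl : c = 1 - a - b := by linarith
  rw [show 3 / (2 * (n : ℝ)) = 3 * (1 / (2 * n)) by ring]
  generalize 1 / (2 * (n : ℝ)) = s
  nlinarith [sq_nonneg (s * (a - b)), sq_nonneg (s * (b - (1 - a - b))),
    sq_nonneg (s * (1 - a - b - a))]

theorem Ex_l2sq_propVec_succ {n : ℕ} (hn : 1 ≤ n) (σ0 : Config n) (t : ℕ) :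
    Ex n (1 / 2) σ0 (t + 1) (fun τ => l2sq (propVec τ)) =
      (1 - 3 / (2 * n)) * Ex n (1 / 2) σ0 t (fun τ => l2sq (propVec τ)) +
        (1 / (2 * n) + 1 / (n : ℝ) ^ 2) := by
  simp only [Ex_succ, funext (stepMean_l2sq_propVec hn), Ex_add, Ex_const_mul, Ex_const hn]

theorem variance_eq {n : ℕ} (hn : 1 ≤ n) (σ0 : Config n) (t : ℕ) :
    Ex n (1 / 2) σ0 t (fun τ => l2sq (fun k => propVec τ k - meanProp n σ0 t k)) =
      Ex n (1 / 2) σ0 t (fun τ => l2sq (propVec τ)) - l2sq (meanProp n σ0 t) := by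
  have hexpand : (fun τ : Config n => l2sq (fun k => propVec τ k - meanProp n σ0 t k)) =
      fun τ => l2sq (propVec τ) + ((-2 * meanProp n σ0 t 0) * propVec τ 0 +
        ((-2 * meanProp n σ0 t 1) * propVec τ 1 +
          ((-2 * meanProp n σ0 t 2) * propVec τ 2 + l2sq (meanProp n σ0 t)))) := by
    funext τ
    simp only [l2sq, Fin.sum_univ_three]
    ring
  have hmean (k : Fin 3) : Ex n (1 / 2) σ0 t (fun τ => propVec τ k) = meanProp n σ0 t k := rfl
  simp only [hexpand, Ex_add, Ex_const_mul, Ex_const hn, hmean]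
  simp only [l2sq, Fin.sum_univ_three]
  ring

/-- the variance of the proportion chain is `O(1/n)` uniformly in
`n ≥ 1`, the starting configuration and the time:
`E_{σ0}‖S_t − E_{σ0}S_t‖₂² ≤ C/n`. -/
theorem proportion_chain_variance_O_inv_n :
    ∃ C : ℝ, 0 < C ∧ ∀ n : ℕ, 1 ≤ n → ∀ σ0 : Config n, ∀ t : ℕ,
      Ex n (1/2) σ0 t
          (fun τ => l2sq (fun k => propVec τ k - Ex n (1/2) σ0 t (fun τ' => propVec τ' k)))
        ≤ C / n := by
  refine ⟨1, one_pos, fun n hn σ0 t => ?_⟩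
  change Ex n (1 / 2) σ0 t (fun τ => l2sq (fun k => propVec τ k - meanProp n σ0 t k)) ≤ 1 / n
  induction t with
  | zero =>
    rw [Ex_zero]
    simp only [meanProp, Ex_zero, sub_self, l2sq]
    simp
  | succ t ih =>
    have hnonneg : 0 ≤ Ex n (1 / 2) σ0 t
        (fun τ => l2sq (fun k => propVec τ k - meanProp n σ0 t k)) :=
      Ex_nonneg n (by norm_num) (by norm_num) σ0 t
        fun τ => Finset.sum_nonneg fun k _ => sq_nonneg _
    have hmean := le_l2sq_meanProp_succ hn σ0 t
    rw [variance_eq hn] at ih hnonneg ⊢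
    rw [Ex_l2sq_propVec_succ hn]
    set W := Ex n (1 / 2) σ0 t (fun τ => l2sq (propVec τ)) - l2sq (meanProp n σ0 t)
    have hs0 : 0 < 1 / (n : ℝ) := by positivity
    have hs1 : 1 / (n : ℝ) ≤ 1 := by
      rw [div_le_one (by positivity)]
      exact_mod_cast hn
    have hcontract : (1 - 3 / (2 * (n : ℝ))) * W + (1 / (n : ℝ)) ^ 2 ≤ 1 / n := by
      rw [show 3 / (2 * (n : ℝ)) = 3 / 2 * (1 / n) by ring]
      nlinarith [mul_nonneg hs0.le hnonneg, mul_nonneg (sub_nonneg.2 hs1) (sub_nonneg.2 ih)]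
    have hW : (1 - 3 / (2 * (n : ℝ))) * W =
        (1 - 3 / (2 * n)) * Ex n (1 / 2) σ0 t (fun τ => l2sq (propVec τ)) -
          (1 - 3 / (2 * n)) * l2sq (meanProp n σ0 t) := mul_sub _ _ _
    rw [div_pow, one_pow] at hcontract
    linarith
end

section
/- Lower bound for the cutoff of the cyclic dynamics with p = 1/2: with t_γ(n) = (2/3) n log n + γ n and d^{(n)}(t) the maximal total variation distance from the uniform measure μ_n at time t, one has lim_{γ→−∞} liminf_{n→∞} d^{(n)}(⌊t_γ(n)⌋) = 1. Equivalently, for every ε > 0 and every sufficiently large −γ > 0, t^{(n)}_mix(1−ε) ≥ t_γ(n) for all sufficiently large n. -/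
open Finset Filter

/-- `ε`-mixing time `t_mix^{(n)}(ε)`. -/
noncomputable def tmix (n : ℕ) (p ε : ℝ) : ℕ :=
  sInf {t : ℕ | dmax n p t ≤ ε}

open scoped ComplexConjugate

/-- The primitive cube root of unity `-1/2 + (√3/2) i`. -/
noncomputable def cubeRoot : ℂ := ⟨-1 / 2, Real.sqrt 3 / 2⟩

lemma cubeRoot_mul_conj : cubeRoot * conj cubeRoot = 1 := by
  have h : Real.sqrt 3 * Real.sqrt 3 = 3 := Real.mul_self_sqrt (by norm_num)
  apply Complex.ext <;> simp [cubeRoot]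
  · nlinarith
  · ring

lemma cubeRoot_add_conj : cubeRoot + conj cubeRoot = -1 := by
  apply Complex.ext <;> simp [cubeRoot]

lemma cubeRoot_sq_add : cubeRoot ^ 2 + cubeRoot + 1 = 0 := by
  linear_combination cubeRoot * cubeRoot_add_conj - cubeRoot_mul_conj

lemma cubeRoot_pow_three : cubeRoot ^ 3 = 1 := by
  linear_combination (cubeRoot - 1) * cubeRoot_sq_add

lemma cubeRoot_ne_one : cubeRoot ≠ 1 := by
  intro h
  have := congrArg Complex.re h
  norm_num [cubeRoot] at this

lemma cubeRoot_pow_mul_conj (k : ℕ) : cubeRoot ^ k * conj (cubeRoot ^ k) = 1 := by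
  rw [map_pow, ← mul_pow, cubeRoot_mul_conj, one_pow]

lemma cubeRoot_pow_val_add_one (a : Fin 3) :
    cubeRoot ^ (a + 1).val = cubeRoot * cubeRoot ^ a.val := by
  fin_cases a
  · simp
  · simp [pow_two]
  · simp [← pow_succ', cubeRoot_pow_three]

section Eigenfunctions

variable {n : ℕ} {F : Config n → ℂ} {c : Fin n → ℂ}

/-- A function multiplied by `c v` when the colour at `v` is increased is an eigenfunction. -/
lemma sum_cyclicP_mul_s8 (hF : ∀ σ v, F (Function.update σ v (σ v + 1)) = c v * F σ)
    (σ : Config n) :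
    ∑ τ, (cyclicP n (1 / 2) σ τ : ℂ) * F τ
      = ((1 / (n : ℂ)) * ∑ v, (1 + c v) / 2) * F σ := by
  have h : ∀ τ, (cyclicP n (1 / 2) σ τ : ℂ) * F τ = (1 / (n : ℂ)) * ∑ v : Fin n,
      ((1 / 2) * (if τ = σ then F τ else 0)
        + (1 / 2) * (if τ = Function.update σ v (σ v + 1) then F τ else 0)) := by
    intro τ
    simp only [cyclicP, Matrix.of_apply]
    push_cast
    rw [mul_assoc, Finset.sum_mul]
    congr 1
    refine Finset.sum_congr rfl fun v _ => ?_
    split_ifs <;> norm_num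
    ring
  simp_rw [h]
  rw [← Finset.mul_sum, Finset.sum_comm, mul_assoc, Finset.sum_mul]
  congr 1
  refine Finset.sum_congr rfl fun v _ => ?_
  rw [Finset.sum_add_distrib, ← Finset.mul_sum, ← Finset.mul_sum]
  simp only [Finset.sum_ite_eq', Finset.mem_univ, if_true, hF]
  ring

lemma sum_lawAt_mul (hF : ∀ σ v, F (Function.update σ v (σ v + 1)) = c v * F σ)
    (t : ℕ) (σ : Config n) :
    ∑ τ, (lawAt n (1 / 2) σ t τ : ℂ) * F τ
      = ((1 / (n : ℂ)) * ∑ v, (1 + c v) / 2) ^ t * F σ := by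
  induction t generalizing σ with
  | zero =>
    simp only [lawAt, pow_zero, Matrix.one_apply, one_mul]
    rw [Finset.sum_eq_single σ] <;> simp +contextual [eq_comm]
  | succ t ih =>
    have h : ∀ τ, (lawAt n (1 / 2) σ (t + 1) τ : ℂ) * F τ
        = ∑ ρ, (cyclicP n (1 / 2) σ ρ : ℂ) * ((lawAt n (1 / 2) ρ t τ : ℂ) * F τ) := by
      intro τ
      simp only [lawAt, pow_succ', Matrix.mul_apply]
      push_cast
      rw [Finset.sum_mul]
      simp only [mul_assoc]
    simp_rw [h]
    rw [Finset.sum_comm]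
    have h' : ∀ ρ, ∑ τ, (cyclicP n (1 / 2) σ ρ : ℂ) * ((lawAt n (1 / 2) ρ t τ : ℂ) * F τ)
        = ((1 / (n : ℂ)) * ∑ v, (1 + c v) / 2) ^ t * ((cyclicP n (1 / 2) σ ρ : ℂ) * F ρ) := by
      intro ρ
      rw [← Finset.mul_sum, ih]
      ring
    simp_rw [h']
    rw [← Finset.mul_sum, sum_cyclicP_mul_s8 hF, pow_succ]
    ring

lemma sum_eq_zero_of_shift (hF : ∀ σ v, F (Function.update σ v (σ v + 1)) = c v * F σ)
    {u : Fin n} (hu : c u ≠ 1) : ∑ τ, F τ = 0 := by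
  have h1 : ∑ τ, F (τ + Pi.single u 1) = ∑ τ, F τ :=
    Fintype.sum_equiv (Equiv.addRight (Pi.single u (1 : Fin 3))) _ _ fun _ => rfl
  have h2 : ∀ τ : Config n, τ + Pi.single u 1 = Function.update τ u (τ u + 1) := by
    intro τ
    ext v
    by_cases hv : v = u
    · subst hv; simp
    · simp [hv]
  simp_rw [h2, hF] at h1
  rw [← Finset.mul_sum] at h1
  have h3 : (c u - 1) * ∑ τ, F τ = 0 := by linear_combination h1
  exact (mul_eq_zero.mp h3).resolve_left (sub_ne_zero.mpr hu)

end Eigenfunctions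

lemma lawAt_nonneg (n : ℕ) (t : ℕ) (σ τ : Config n) : 0 ≤ lawAt n (1 / 2) σ t τ := by
  have hP : ∀ σ τ, 0 ≤ cyclicP n (1 / 2) σ τ := by
    intro σ τ
    simp only [cyclicP, Matrix.of_apply]
    refine mul_nonneg (by positivity) (Finset.sum_nonneg fun v _ => ?_)
    split_ifs <;> norm_num
  induction t generalizing σ with
  | zero =>
    simp only [lawAt, pow_zero, Matrix.one_apply]
    split_ifs <;> norm_num
  | succ t ih =>
    simp only [lawAt, pow_succ', Matrix.mul_apply]
    exact Finset.sum_nonneg fun ρ _ => mul_nonneg (hP _ _) (ih ρ)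

lemma sum_lawAt {n : ℕ} (hn : n ≠ 0) (t : ℕ) (σ : Config n) :
    ∑ τ, lawAt n (1 / 2) σ t τ = 1 := by
  have h := sum_lawAt_mul (n := n) (F := fun _ => 1) (c := fun _ => 1) (by simp) t σ
  have hn' : (n : ℂ) ≠ 0 := by exact_mod_cast hn
  have h2 : (1 / (n : ℂ)) * ∑ _v : Fin n, ((1 : ℂ) + 1) / 2 = 1 := by
    simp [hn']
  rw [h2] at h
  simp only [mul_one, one_pow] at h
  exact_mod_cast h

lemma unif_nonneg (n : ℕ) (τ : Config n) : 0 ≤ unif n τ := by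
  unfold unif; positivity

lemma sum_unif (n : ℕ) : ∑ τ, unif n τ = 1 := by
  simp [unif]

section TotalVariation

variable {X : Type*} [Fintype X] {μ ν : X → ℝ}

lemma abs_sub_le_tvDist (A : Finset X) :
    |∑ x ∈ A, μ x - ∑ x ∈ A, ν x| ≤ tvDist μ ν :=
  le_ciSup (f := fun A : Finset X => |∑ x ∈ A, μ x - ∑ x ∈ A, ν x|)
    (Set.finite_range _).bddAbove A

lemma tvDist_le_one (hμ : ∀ x, 0 ≤ μ x) (hν : ∀ x, 0 ≤ ν x)
    (hμ1 : ∑ x, μ x = 1) (hν1 : ∑ x, ν x = 1) : tvDist μ ν ≤ 1 := by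
  refine ciSup_le fun A => ?_
  have a1 : 0 ≤ ∑ x ∈ A, μ x := Finset.sum_nonneg fun x _ => hμ x
  have a2 : 0 ≤ ∑ x ∈ A, ν x := Finset.sum_nonneg fun x _ => hν x
  have b1 : ∑ x ∈ A, μ x ≤ 1 :=
    hμ1 ▸ Finset.sum_le_univ_sum_of_nonneg hμ
  have b2 : ∑ x ∈ A, ν x ≤ 1 :=
    hν1 ▸ Finset.sum_le_univ_sum_of_nonneg hν
  rw [abs_le]
  constructor <;> linarith

lemma tvDist_le_sum_abs : tvDist μ ν ≤ ∑ x, |μ x - ν x| := by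
  refine ciSup_le fun A => ?_
  rw [← Finset.sum_sub_distrib]
  exact (Finset.abs_sum_le_sum_abs _ _).trans
    (Finset.sum_le_univ_sum_of_nonneg fun x => abs_nonneg _)

/-- Chebyshev's inequality for a nonnegative weight on a finite type. -/
lemma sum_filter_le_of_sq {g : X → ℝ} {r V : ℝ} {A : Finset X} (hμ : ∀ x, 0 ≤ μ x)
    (hr : 0 < r) (hA : ∀ x ∈ A, r ≤ g x) (hV : ∑ x, μ x * g x ^ 2 ≤ V) :
    ∑ x ∈ A, μ x ≤ V / r ^ 2 := by
  rw [le_div_iff₀ (by positivity), Finset.sum_mul]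
  calc ∑ x ∈ A, μ x * r ^ 2 ≤ ∑ x ∈ A, μ x * g x ^ 2 := by
        refine Finset.sum_le_sum fun x hx => ?_
        have := hA x hx
        have := hμ x
        gcongr
    _ ≤ ∑ x, μ x * g x ^ 2 :=
        Finset.sum_le_univ_sum_of_nonneg fun x => mul_nonneg (hμ x) (sq_nonneg _)
    _ ≤ V := hV

/-- Second-moment lower bound on the total variation distance. -/
lemma one_sub_le_tvDist {f : X → ℂ} {m : ℂ} {V : ℝ} (hμ : ∀ x, 0 ≤ μ x) (hν : ∀ x, 0 ≤ ν x)
    (hμ1 : ∑ x, μ x = 1) (hm : m ≠ 0)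
    (hμV : ∑ x, μ x * ‖f x - m‖ ^ 2 ≤ V) (hνV : ∑ x, ν x * ‖f x‖ ^ 2 ≤ V) :
    1 - 8 * V / ‖m‖ ^ 2 ≤ tvDist μ ν := by
  classical
  have hm' : 0 < ‖m‖ / 2 := by have := norm_pos_iff.mpr hm; positivity
  set A : Finset X := Finset.univ.filter fun x => ‖m‖ / 2 ≤ ‖f x‖ with hA
  have h1 : ∑ x ∈ A, ν x ≤ V / (‖m‖ / 2) ^ 2 :=
    sum_filter_le_of_sq hν hm' (fun x hx => (Finset.mem_filter.mp hx).2) hνV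
  have h2 : ∑ x ∈ Aᶜ, μ x ≤ V / (‖m‖ / 2) ^ 2 := by
    refine sum_filter_le_of_sq hμ hm' (fun x hx => ?_) hμV
    have hx' : ‖f x‖ < ‖m‖ / 2 := by simpa [hA] using hx
    have := norm_sub_norm_le m (f x)
    rw [norm_sub_rev] at this
    linarith
  have h3 := Finset.sum_add_sum_compl A μ
  have h4 := (le_abs_self _).trans (abs_sub_le_tvDist (μ := μ) (ν := ν) A)
  have h5 : 8 * V / ‖m‖ ^ 2 = 2 * (V / (‖m‖ / 2) ^ 2) := by
    have := norm_pos_iff.mpr hm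
    field_simp
    ring
  rw [h5]
  linarith

lemma sum_mul_norm_sub_sq {f : X → ℂ} {m : ℂ} (hμ1 : ∑ x, μ x = 1)
    (hm : ∑ x, (μ x : ℂ) * f x = m) :
    ∑ x, μ x * ‖f x - m‖ ^ 2 = ∑ x, μ x * ‖f x‖ ^ 2 - ‖m‖ ^ 2 := by
  have hre : ∑ x, μ x * (f x).re = m.re := by
    have := congrArg Complex.re hm
    simpa using this
  have him : ∑ x, μ x * (f x).im = m.im := by
    have := congrArg Complex.im hm
    simpa using this
  have h : ∀ x, μ x * ‖f x - m‖ ^ 2 = μ x * ‖f x‖ ^ 2 - 2 * m.re * (μ x * (f x).re)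
      - 2 * m.im * (μ x * (f x).im) + ‖m‖ ^ 2 * μ x := by
    intro x
    simp only [Complex.sq_norm, Complex.normSq_apply, Complex.sub_re, Complex.sub_im]
    ring
  simp_rw [h]
  rw [Finset.sum_add_distrib, Finset.sum_sub_distrib, Finset.sum_sub_distrib,
    ← Finset.mul_sum, ← Finset.mul_sum, ← Finset.mul_sum, hre, him, hμ1]
  simp only [Complex.sq_norm, Complex.normSq_apply]
  ring

end TotalVariation

lemma tvDist_le_dmax (n t : ℕ) (σ : Config n) :
    tvDist (lawAt n (1 / 2) σ t) (unif n) ≤ dmax n (1 / 2) t :=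
  le_ciSup (f := fun σ => tvDist (lawAt n (1 / 2) σ t) (unif n))
    (Set.finite_range _).bddAbove σ

lemma dmax_le_one {n : ℕ} (hn : n ≠ 0) (t : ℕ) : dmax n (1 / 2) t ≤ 1 :=
  ciSup_le fun σ => tvDist_le_one (lawAt_nonneg n t σ) (unif_nonneg n) (sum_lawAt hn t σ)
    (sum_unif n)

/-- The magnetization `∑ v, ω ^ σ(v)`. -/
noncomputable def magnetization {n : ℕ} (σ : Config n) : ℂ := ∑ v, cubeRoot ^ (σ v).val

lemma cubeRoot_pow_update {n : ℕ} (u : Fin n) (σ : Config n) (v : Fin n) :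
    cubeRoot ^ (Function.update σ v (σ v + 1) u).val
      = (if v = u then cubeRoot else 1) * cubeRoot ^ (σ u).val := by
  by_cases h : v = u
  · subst h; simp [cubeRoot_pow_val_add_one]
  · simp [h, Function.update_of_ne (Ne.symm h)]

lemma cubeRoot_pow_mul_conj_update {n : ℕ} {u w : Fin n} (huw : u ≠ w) (σ : Config n)
    (v : Fin n) :
    cubeRoot ^ (Function.update σ v (σ v + 1) u).val
        * conj (cubeRoot ^ (Function.update σ v (σ v + 1) w).val)
      = (if v = u then cubeRoot else if v = w then conj cubeRoot else 1)
        * (cubeRoot ^ (σ u).val * conj (cubeRoot ^ (σ w).val)) := by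
  rw [cubeRoot_pow_update, cubeRoot_pow_update, map_mul]
  by_cases h : v = u
  · subst h; simp [huw, mul_assoc]
  · by_cases h' : v = w
    · subst h'; simp [h]; ring
    · simp [h, h']

/-- Second moment of the magnetization when all pair correlations are equal. -/
lemma sum_mul_norm_magnetization_sq {n : ℕ} {μ : Config n → ℝ} {κ : ℝ}
    (hμ1 : ∑ τ, μ τ = 1)
    (hκ : ∀ u w : Fin n, u ≠ w →
      ∑ τ, (μ τ : ℂ) * (cubeRoot ^ (τ u).val * conj (cubeRoot ^ (τ w).val)) = κ) :
    ∑ τ, μ τ * ‖magnetization τ‖ ^ 2 = n + n * (n - 1) * κ := by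
  have h : ∀ τ : Config n, ((μ τ * ‖magnetization τ‖ ^ 2 : ℝ) : ℂ)
      = ∑ u, ∑ w, (μ τ : ℂ) * (cubeRoot ^ (τ u).val * conj (cubeRoot ^ (τ w).val)) := by
    intro τ
    push_cast
    rw [← Complex.mul_conj', magnetization, map_sum, Finset.sum_mul_sum, Finset.mul_sum]
    exact Finset.sum_congr rfl fun u _ => Finset.mul_sum _ _ _
  have hC : ((∑ τ, μ τ * ‖magnetization τ‖ ^ 2 : ℝ) : ℂ)
      = ((n + n * (n - 1) * κ : ℝ) : ℂ) := by
    rw [Complex.ofReal_sum]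
    simp_rw [h]
    rw [Finset.sum_comm]
    have hu : ∀ u : Fin n, ∑ τ, ∑ w, (μ τ : ℂ) *
        (cubeRoot ^ (τ u).val * conj (cubeRoot ^ (τ w).val)) = 1 + (n - 1) * κ := by
      intro u
      rw [Finset.sum_comm, ← Finset.add_sum_erase _ _ (Finset.mem_univ u)]
      congr 1
      · simp_rw [cubeRoot_pow_mul_conj, mul_one]
        exact_mod_cast hμ1
      · rw [Finset.sum_congr rfl fun w hw => hκ u w (Finset.ne_of_mem_erase hw).symm]
        rw [Finset.sum_const, Finset.card_erase_of_mem (Finset.mem_univ u), nsmul_eq_mul,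
          Finset.card_univ, Fintype.card_fin, Nat.cast_pred (Fin.pos u)]
    rw [Finset.sum_congr rfl fun u _ => hu u]
    simp
    ring
  exact_mod_cast hC

lemma sum_unif_mul_norm_magnetization_sq (n : ℕ) :
    ∑ τ, unif n τ * ‖magnetization τ‖ ^ 2 = n := by
  rw [sum_mul_norm_magnetization_sq (κ := 0) (sum_unif n)]
  · ring
  · intro u w huw
    simp only [unif]
    rw [← Finset.mul_sum, sum_eq_zero_of_shift (cubeRoot_pow_mul_conj_update huw) (u := u)]
    · simp
    · simpa using cubeRoot_ne_one

lemma sum_lawAt_mul_magnetization {n : ℕ} (hn : n ≠ 0) (t : ℕ) :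
    ∑ τ, (lawAt n (1 / 2) 0 t τ : ℂ) * magnetization τ
      = n * (1 - (1 - cubeRoot) / (2 * n)) ^ t := by
  have hn' : (n : ℂ) ≠ 0 := by exact_mod_cast hn
  simp only [magnetization, Finset.mul_sum]
  rw [Finset.sum_comm]
  have h : ∀ u : Fin n, ∑ τ, (lawAt n (1 / 2) 0 t τ : ℂ) * cubeRoot ^ (τ u).val
      = (1 - (1 - cubeRoot) / (2 * n)) ^ t := by
    intro u
    rw [sum_lawAt_mul (F := fun τ => cubeRoot ^ (τ u).val) (cubeRoot_pow_update u) t 0]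
    have hs : (1 / (n : ℂ)) * ∑ v : Fin n, (1 + if v = u then cubeRoot else 1) / 2
        = 1 - (1 - cubeRoot) / (2 * n) := by
      have : ∀ v : Fin n, (1 + if v = u then cubeRoot else 1) / 2
          = 1 + if v = u then (cubeRoot - 1) / 2 else 0 := by
        intro v; split_ifs <;> ring
      simp_rw [this]
      rw [Finset.sum_add_distrib]
      simp
      field_simp
      ring
    rw [hs]
    simp
  rw [Finset.sum_congr rfl fun u _ => h u]
  simp

lemma sum_lawAt_mul_pair {n : ℕ} {u w : Fin n} (huw : u ≠ w) (t : ℕ) :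
    ∑ τ, (lawAt n (1 / 2) 0 t τ : ℂ) * (cubeRoot ^ (τ u).val * conj (cubeRoot ^ (τ w).val))
      = ((1 - 3 / (2 * n)) ^ t : ℝ) := by
  have hn' : (n : ℂ) ≠ 0 := by exact_mod_cast (Fin.pos u).ne'
  rw [sum_lawAt_mul (F := fun τ => cubeRoot ^ (τ u).val * conj (cubeRoot ^ (τ w).val))
    (cubeRoot_pow_mul_conj_update huw) t 0]
  have hs : (1 / (n : ℂ)) * ∑ v : Fin n,
      (1 + if v = u then cubeRoot else if v = w then conj cubeRoot else 1) / 2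
      = 1 - 3 / (2 * n) := by
    have : ∀ v : Fin n, (1 + if v = u then cubeRoot else if v = w then conj cubeRoot else 1) / 2
        = 1 + ((if v = u then (cubeRoot - 1) / 2 else 0)
          + if v = w then (conj cubeRoot - 1) / 2 else 0) := by
      intro v
      by_cases h : v = u
      · subst h; simp [huw]; ring
      · by_cases h' : v = w
        · simp [h', huw.symm]; ring
        · simp [h, h']
    simp_rw [this]
    rw [Finset.sum_add_distrib, Finset.sum_add_distrib]
    simp
    field_simp
    linear_combination cubeRoot_add_conj
  rw [hs]
  simp

lemma norm_eigenvalue_sq {n : ℕ} (hn : n ≠ 0) :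
    1 - 3 / (2 * (n : ℝ)) ≤ ‖1 - (1 - cubeRoot) / (2 * n)‖ ^ 2 := by
  have hn' : (n : ℝ) ≠ 0 := by exact_mod_cast hn
  have h3 : Real.sqrt 3 * Real.sqrt 3 = 3 := Real.mul_self_sqrt (by norm_num)
  have h : (1 : ℂ) - (1 - cubeRoot) / (2 * n)
      = ⟨1 - 3 / (4 * n), Real.sqrt 3 / (4 * n)⟩ := by
    have : (2 * (n : ℂ)) = ((2 * n : ℝ) : ℂ) := by push_cast; ring
    rw [this]
    apply Complex.ext <;>
      simp only [cubeRoot, Complex.sub_re, Complex.sub_im, Complex.div_ofReal_re,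
        Complex.div_ofReal_im, Complex.one_re, Complex.one_im] <;> field_simp <;> ring
  rw [h, Complex.sq_norm, Complex.normSq_apply]
  have : (1 - 3 / (4 * (n : ℝ))) * (1 - 3 / (4 * n))
      + Real.sqrt 3 / (4 * n) * (Real.sqrt 3 / (4 * n))
      = 1 - 3 / (2 * (n : ℝ)) + 3 / (4 * n ^ 2) := by
    field_simp
    linear_combination 2 * h3
  rw [this]
  have : 0 ≤ 3 / (4 * (n : ℝ) ^ 2) := by positivity
  linarith

lemma one_sub_le_dmax {n : ℕ} (hn : 2 ≤ n) (t : ℕ) :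
    1 - 8 / (n * (1 - 3 / (2 * (n : ℝ))) ^ t) ≤ dmax n (1 / 2) t := by
  have hn0 : n ≠ 0 := by omega
  have hnR : (2 : ℝ) ≤ n := by exact_mod_cast hn
  have hx : 0 < 1 - 3 / (2 * (n : ℝ)) := by
    rw [sub_pos, div_lt_one (by positivity)]
    linarith
  set κ : ℝ := (1 - 3 / (2 * (n : ℝ))) ^ t with hκ
  have hκ0 : 0 < κ := pow_pos hx t
  set m : ℂ := n * (1 - (1 - cubeRoot) / (2 * n)) ^ t with hm
  have hm2 : (n : ℝ) ^ 2 * κ ≤ ‖m‖ ^ 2 := by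
    have : ‖m‖ ^ 2 = n ^ 2 * (‖1 - (1 - cubeRoot) / (2 * n)‖ ^ 2) ^ t := by
      rw [hm, norm_mul, norm_pow, mul_pow, Complex.norm_natCast, ← pow_mul, ← pow_mul,
        mul_comm t 2]
    rw [this, hκ]
    gcongr
    exact norm_eigenvalue_sq hn0
  have hmpos : 0 < ‖m‖ ^ 2 := lt_of_lt_of_le (by positivity) hm2
  have hm0 : m ≠ 0 := by
    intro h
    simp [h] at hmpos
  have hvar : ∑ τ, lawAt n (1 / 2) 0 t τ * ‖magnetization τ - m‖ ^ 2 ≤ n := by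
    rw [sum_mul_norm_sub_sq (sum_lawAt hn0 t 0) (sum_lawAt_mul_magnetization hn0 t),
      sum_mul_norm_magnetization_sq (sum_lawAt hn0 t 0)
        (fun u w huw => sum_lawAt_mul_pair huw t)]
    nlinarith
  have h := (one_sub_le_tvDist (lawAt_nonneg n t 0) (unif_nonneg n) (sum_lawAt hn0 t 0) hm0
    hvar (sum_unif_mul_norm_magnetization_sq n).le).trans (tvDist_le_dmax n t 0)
  refine le_trans ?_ h
  have : 8 * (n : ℝ) / ‖m‖ ^ 2 ≤ 8 / (n * κ) := by
    calc 8 * (n : ℝ) / ‖m‖ ^ 2 ≤ 8 * (n : ℝ) / (n ^ 2 * κ) := by gcongr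
      _ = 8 / (n * κ) := by field_simp
  linarith

lemma exp_le_mul_pow {n : ℕ} (hn : 3 ≤ n) {γ : ℝ} (hγ : γ ≤ 0) {t : ℕ}
    (ht : (t : ℝ) ≤ (2 / 3) * n * Real.log n + γ * n) :
    Real.exp (-3 - 3 / 2 * γ) ≤ n * (1 - 3 / (2 * (n : ℝ))) ^ t := by
  have hnR : (3 : ℝ) ≤ n := by exact_mod_cast hn
  have hn0 : (0 : ℝ) < n := by linarith
  set x : ℝ := 3 / (2 * (n : ℝ)) with hxdef
  have hx0 : 0 < x := by positivity
  have hx : x ≤ 1 / 2 := by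
    rw [hxdef, div_le_iff₀ (by positivity)]
    linarith
  have hexp : Real.exp (-(x * (1 + 2 * x))) ≤ 1 - x := by
    rw [Real.exp_neg, inv_le_comm₀ (Real.exp_pos _) (by linarith)]
    calc (1 - x)⁻¹ ≤ x * (1 + 2 * x) + 1 := by
          rw [inv_le_iff_one_le_mul₀ (by linarith)]
          nlinarith [mul_nonneg (sq_nonneg x) (by linarith : (0 : ℝ) ≤ 1 - 2 * x)]
      _ ≤ _ := Real.add_one_le_exp _
  have hlog : Real.log n ≤ n := (Real.log_le_sub_one_of_pos hn0).trans (by linarith)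
  have htx : t * x ≤ Real.log n + 3 / 2 * γ := by
    calc t * x ≤ ((2 / 3) * n * Real.log n + γ * n) * x := by gcongr
      _ = _ := by rw [hxdef]; field_simp
  have hmain : t * (x * (1 + 2 * x)) ≤ Real.log n + 3 / 2 * γ + 3 := by
    have h2 : t * x * (2 * x) ≤ n * (2 * x) := by
      gcongr
      linarith
    have h3 : n * (2 * x) = 3 := by rw [hxdef]; field_simp
    nlinarith
  calc Real.exp (-3 - 3 / 2 * γ)
      ≤ Real.exp (Real.log n + t * (-(x * (1 + 2 * x)))) := by
        apply Real.exp_le_exp.mpr; linarith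
    _ = n * Real.exp (-(x * (1 + 2 * x))) ^ t := by
        rw [Real.exp_add, Real.exp_log hn0, Real.exp_nat_mul]
    _ ≤ n * (1 - x) ^ t := by gcongr

lemma one_sub_exp_le_dmax {n : ℕ} (hn : 3 ≤ n) {γ : ℝ} (hγ : γ ≤ 0) {t : ℕ}
    (ht : (t : ℝ) ≤ (2 / 3) * n * Real.log n + γ * n) :
    1 - 8 * Real.exp (3 + 3 / 2 * γ) ≤ dmax n (1 / 2) t := by
  refine le_trans ?_ (one_sub_le_dmax (by omega) t)
  have h := exp_le_mul_pow hn hγ ht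
  have : 8 / (n * (1 - 3 / (2 * (n : ℝ))) ^ t) ≤ 8 / Real.exp (-3 - 3 / 2 * γ) := by
    gcongr
  have h2 : 8 / Real.exp (-3 - 3 / 2 * γ) = 8 * Real.exp (3 + 3 / 2 * γ) := by
    rw [div_eq_mul_inv, ← Real.exp_neg]
    ring_nf
  linarith

/-! ### Convergence to the uniform measure -/

lemma indicator_eq_sum_pow (a b : Fin 3) :
    (if a = b then (1 : ℂ) else 0)
      = ∑ j : Fin 3, (1 / 3) * conj (cubeRoot ^ (j.val * b.val)) * cubeRoot ^ (j.val * a.val) := by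
  have hc : conj cubeRoot = cubeRoot ^ 2 := by
    linear_combination cubeRoot_add_conj - cubeRoot_sq_add
  have h3 := cubeRoot_pow_three
  have h2 := cubeRoot_sq_add
  simp only [map_pow, hc, ← pow_mul, mul_assoc, ← pow_add]
  rw [Fin.sum_univ_three]
  have h4 : cubeRoot ^ 4 = cubeRoot := by linear_combination cubeRoot * h3
  have h5 : cubeRoot ^ 5 = cubeRoot ^ 2 := by linear_combination cubeRoot ^ 2 * h3
  have h6 : cubeRoot ^ 6 = 1 := by linear_combination (cubeRoot ^ 3 + 1) * h3
  have h8 : cubeRoot ^ 8 = cubeRoot ^ 2 := by linear_combination cubeRoot ^ 2 * h6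
  have h10 : cubeRoot ^ 10 = cubeRoot := by
    linear_combination cubeRoot ^ 4 * h6 + h4
  have h12 : cubeRoot ^ 12 = 1 := by linear_combination (cubeRoot ^ 6 + 1) * h6
  fin_cases a <;> fin_cases b <;>
    simp [h3, h4, h5, h6, h8, h10, h12] <;>
    first | (norm_num; done) | (linear_combination (-1 / 3) * h2)

lemma cubeRoot_pow_mul_val_add_one (j : ℕ) (a : Fin 3) :
    cubeRoot ^ (j * (a + 1).val) = cubeRoot ^ j * cubeRoot ^ (j * a.val) := by
  rw [mul_comm j, mul_comm j, pow_mul, cubeRoot_pow_val_add_one, mul_pow, pow_mul]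

/-- The character of `(ℤ/3)^n` with frequency `k`. -/
noncomputable def character {n : ℕ} (k τ : Config n) : ℂ :=
  ∏ v, cubeRoot ^ ((k v).val * (τ v).val)

lemma character_update {n : ℕ} (k σ : Config n) (v : Fin n) :
    character k (Function.update σ v (σ v + 1)) = cubeRoot ^ (k v).val * character k σ := by
  simp only [character]
  rw [← Finset.mul_prod_erase _ _ (Finset.mem_univ v),
    ← Finset.mul_prod_erase (a := v) (s := univ)
      (f := fun w => cubeRoot ^ ((k w).val * (σ w).val)) (Finset.mem_univ v),
    Function.update_self, cubeRoot_pow_mul_val_add_one, mul_assoc]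
  congr 2
  refine Finset.prod_congr rfl fun w hw => ?_
  rw [Function.update_of_ne (Finset.ne_of_mem_erase hw)]

lemma indicator_eq_sum_character {n : ℕ} (ρ τ : Config n) :
    (if ρ = τ then (1 : ℂ) else 0)
      = ∑ k : Config n, (1 / 3) ^ n * conj (character k τ) * character k ρ := by
  have h1 : (if ρ = τ then (1 : ℂ) else 0) = ∏ v, if ρ v = τ v then (1 : ℂ) else 0 := by
    rw [Finset.prod_ite_zero]
    simp [funext_iff]
  rw [h1]
  simp_rw [indicator_eq_sum_pow]
  rw [Finset.prod_univ_sum]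
  simp only [Fintype.piFinset_univ, Finset.prod_mul_distrib, character, map_prod,
    Finset.prod_const, Finset.card_univ, Fintype.card_fin]

lemma lawAt_eq_sum {n : ℕ} (σ τ : Config n) (t : ℕ) :
    (lawAt n (1 / 2) σ t τ : ℂ) = ∑ k : Config n, (1 / 3) ^ n * conj (character k τ) *
      (((1 / (n : ℂ)) * ∑ v, (1 + cubeRoot ^ (k v).val) / 2) ^ t * character k σ) := by
  have h : (lawAt n (1 / 2) σ t τ : ℂ)
      = ∑ ρ, (lawAt n (1 / 2) σ t ρ : ℂ) * (if ρ = τ then (1 : ℂ) else 0) := by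
    simp
  rw [h]
  simp_rw [indicator_eq_sum_character, Finset.mul_sum]
  rw [Finset.sum_comm]
  refine Finset.sum_congr rfl fun k _ => ?_
  rw [← Finset.mul_sum, ← sum_lawAt_mul (character_update k), Finset.mul_sum]
  exact Finset.sum_congr rfl fun ρ _ => by ring

lemma norm_one_add_cubeRoot_pow_lt {a : Fin 3} (ha : a ≠ 0) :
    ‖(1 + cubeRoot ^ a.val) / 2‖ < 1 := by
  have h3 : Real.sqrt 3 * Real.sqrt 3 = 3 := Real.mul_self_sqrt (by norm_num)
  have hb : ‖cubeRoot‖ ^ 2 = 1 := by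
    rw [Complex.sq_norm, Complex.normSq_apply]
    simp only [cubeRoot]
    nlinarith
  have hb' : ‖cubeRoot‖ = 1 := by
    nlinarith [norm_nonneg cubeRoot]
  have key : ‖1 + cubeRoot ^ a.val‖ = 1 := by
    fin_cases a
    · simp at ha
    · have : 1 + cubeRoot = -cubeRoot ^ 2 := by linear_combination cubeRoot_sq_add
      simp [this, hb']
    · have : 1 + cubeRoot ^ 2 = -cubeRoot := by linear_combination cubeRoot_sq_add
      simp [this, hb']
  rw [norm_div, key]
  norm_num

lemma norm_one_add_cubeRoot_pow_le (a : Fin 3) : ‖(1 + cubeRoot ^ a.val) / 2‖ ≤ 1 := by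
  by_cases ha : a = 0
  · subst ha; simp
  · exact (norm_one_add_cubeRoot_pow_lt ha).le

lemma norm_eigenvalue_lt_one {n : ℕ} {k : Config n} (hk : k ≠ 0) :
    ‖(1 / (n : ℂ)) * ∑ v, (1 + cubeRoot ^ (k v).val) / 2‖ < 1 := by
  obtain ⟨u, hu⟩ := Function.ne_iff.mp hk
  have hn : (0 : ℝ) < n := by exact_mod_cast Fin.pos u
  have h : ‖∑ v, (1 + cubeRoot ^ (k v).val) / 2‖ < n := by
    calc ‖∑ v, (1 + cubeRoot ^ (k v).val) / 2‖
        ≤ ∑ v, ‖(1 + cubeRoot ^ (k v).val) / 2‖ := norm_sum_le _ _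
      _ < ∑ _v : Fin n, (1 : ℝ) :=
          Finset.sum_lt_sum (fun v _ => norm_one_add_cubeRoot_pow_le (k v))
            ⟨u, Finset.mem_univ u, norm_one_add_cubeRoot_pow_lt hu⟩
      _ = n := by simp
  rw [norm_mul, norm_div, norm_one, Complex.norm_natCast, one_div, inv_mul_lt_iff₀ hn, mul_one]
  exact h

lemma tendsto_lawAt {n : ℕ} (hn : n ≠ 0) (σ τ : Config n) :
    Tendsto (fun t => lawAt n (1 / 2) σ t τ) atTop (nhds (unif n τ)) := by
  have hn' : (n : ℂ) ≠ 0 := by exact_mod_cast hn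
  have hC : Tendsto (fun t => (lawAt n (1 / 2) σ t τ : ℂ)) atTop
      (nhds (∑ k : Config n, if k = 0 then ((1 : ℂ) / 3) ^ n else 0)) := by
    simp_rw [lawAt_eq_sum]
    refine tendsto_finsetSum _ fun k _ => ?_
    by_cases hk : k = 0
    · subst hk
      simp [character, hn']
    · rw [if_neg hk]
      have := tendsto_pow_atTop_nhds_zero_of_norm_lt_one (norm_eigenvalue_lt_one hk)
      have := (this.mul_const (character k σ)).const_mul ((1 / 3) ^ n * conj (character k τ))
      simpa using this
  have hre := (Complex.continuous_re.tendsto _).comp hC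
  have hlim : (∑ k : Config n, if k = 0 then ((1 : ℂ) / 3) ^ n else 0)
      = ((unif n τ : ℝ) : ℂ) := by
    simp [unif]
  rw [hlim] at hre
  simpa [Function.comp_def] using hre

lemma exists_dmax_le {n : ℕ} (hn : n ≠ 0) {δ : ℝ} (hδ : 0 < δ) :
    ∃ t, dmax n (1 / 2) t ≤ δ := by
  have h : ∀ σ : Config n, ∀ᶠ t in atTop,
      ∑ τ, |lawAt n (1 / 2) σ t τ - unif n τ| < δ := by
    intro σ
    have hs : Tendsto (fun t => ∑ τ, |lawAt n (1 / 2) σ t τ - unif n τ|) atTop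
        (nhds (∑ _τ : Config n, 0)) := by
      refine tendsto_finsetSum _ fun τ _ => ?_
      have := ((tendsto_lawAt hn σ τ).sub_const (unif n τ)).abs
      simpa using this
    rw [Finset.sum_const_zero] at hs
    exact hs.eventually_lt_const hδ
  obtain ⟨t, ht⟩ := (eventually_all.mpr h).exists
  exact ⟨t, ciSup_le fun σ => tvDist_le_sum_abs.trans (ht σ).le⟩

lemma eventually_nonneg_time (γ : ℝ) :
    ∀ᶠ n : ℕ in atTop, 0 ≤ (2 / 3) * n * Real.log n + γ * n := by
  have h : Tendsto (fun n : ℕ => Real.log n) atTop atTop :=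
    Real.tendsto_log_atTop.comp tendsto_natCast_atTop_atTop
  filter_upwards [h.eventually_ge_atTop (-(3 / 2) * γ)] with n hn
  have : (2 / 3) * n * Real.log n + γ * n = n * (2 / 3 * Real.log n + γ) := by ring
  rw [this]
  exact mul_nonneg (Nat.cast_nonneg n) (by linarith)

lemma tendsto_one_sub_exp :
    Tendsto (fun γ : ℝ => 1 - 8 * Real.exp (3 + 3 / 2 * γ)) atBot (nhds 1) := by
  have h : Tendsto (fun γ : ℝ => 3 + 3 / 2 * γ) atBot atBot :=
    tendsto_atBot_add_const_left _ _ (tendsto_id.const_mul_atBot (by norm_num))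
  simpa using ((Real.tendsto_exp_atBot.comp h).const_mul 8).const_sub 1

/-- lower bound for the cutoff of the cyclic dynamics with `p = 1/2`:
with `t_γ(n) = (2/3) n log n + γ n`, `lim_{γ→−∞} liminf_n d^{(n)}(⌊t_γ(n)⌋) = 1`;
equivalently, for every `ε ∈ (0,1)` and all sufficiently large `−γ`,
`t_mix^{(n)}(1−ε) ≥ t_γ(n)` for all large `n`. -/
theorem cyclic_dynamics_lower_bound :
    Tendsto (fun γ : ℝ => liminf (fun n : ℕ =>
        dmax n (1/2) ⌊(2/3) * n * Real.log n + γ * n⌋₊) atTop) atBot (nhds 1)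
    ∧ ∀ ε : ℝ, 0 < ε → ε < 1 → ∃ Γ : ℝ, 0 < Γ ∧ ∀ γ : ℝ, γ ≤ -Γ →
        ∃ N : ℕ, ∀ n : ℕ, N ≤ n →
          (2/3) * n * Real.log n + γ * n ≤ (tmix n (1/2) (1 - ε) : ℝ) := by
  constructor
  · refine tendsto_of_tendsto_of_tendsto_of_le_of_le' tendsto_one_sub_exp
      tendsto_const_nhds ?_ ?_
    · filter_upwards [eventually_le_atBot 0] with γ hγ
      refine le_liminf_of_le ?_ ?_
      · exact IsBoundedUnder.isCoboundedUnder_ge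
          ⟨1, eventually_map.mpr <| (eventually_ge_atTop 1).mono fun n hn =>
            dmax_le_one (by omega) _⟩
      · filter_upwards [eventually_nonneg_time γ, eventually_ge_atTop 3] with n hT hn
        exact one_sub_exp_le_dmax hn hγ (Nat.floor_le hT)
    · filter_upwards [eventually_le_atBot 0] with γ hγ
      refine liminf_le_of_frequently_le ?_ ?_
      · exact ((eventually_ge_atTop 1).mono fun n hn => dmax_le_one (by omega) _).frequently
      · refine ⟨1 - 8 * Real.exp (3 + 3 / 2 * γ), eventually_map.mpr ?_⟩
        filter_upwards [eventually_nonneg_time γ, eventually_ge_atTop 3] with n hT hn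
        exact one_sub_exp_le_dmax hn hγ (Nat.floor_le hT)
  · intro ε hε hε1
    obtain ⟨a, ha⟩ := eventually_atBot.mp
      (tendsto_one_sub_exp.eventually_const_lt (by linarith : 1 - ε < 1))
    refine ⟨max 1 (-a), by positivity, fun γ hγ => ?_⟩
    have hγa : γ ≤ a := by linarith [le_max_right 1 (-a)]
    have hγ0 : γ ≤ 0 := by linarith [le_max_left 1 (-a)]
    refine ⟨3, fun n hn => ?_⟩
    by_contra! hlt
    have hmem : dmax n (1 / 2) (tmix n (1 / 2) (1 - ε)) ≤ 1 - ε :=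
      Nat.sInf_mem (exists_dmax_le (by omega) (by linarith : 0 < 1 - ε))
    linarith [ha γ hγa, one_sub_exp_le_dmax hn hγ0 hlt.le]
end
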